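/- There is a universal constant K > 0 such that for all N ≥ 1, all β ∈ (0,1], and all t ∈ [0,1], |E⟨R⁻(σ¹,τ¹)²·R(σ²,τ²)²⟩_{t,0} − E⟨R⁻(σ¹,τ¹)²·R(σ²,τ²)²⟩_t| ≤ K·(E⟨R(σ¹,τ¹)²·R(σ²,τ²)²⟩_t)^{1/2}·(E⟨R(σ¹,σ²)^{12}⟩)^{1/3}, and consequently the left-hand side is at most K·(E⟨R(σ¹,σ²)^{12}⟩)^{1/2}; here ⟨·⟩ is the Gibbs average of the original single SK system at inverse temperature β. -/

import Mathlib

open MeasureTheory ProbabilityTheory Real Finset Filter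

noncomputable section

/-- Spin configurations: each of the `N` sites carries a `±1` spin, encoded by a `Bool`. -/
abbrev Config (N : ℕ) := Fin N → Bool

/-- The `±1` value of a spin. -/
def spin (b : Bool) : ℝ := if b then 1 else -1

/-- The value of the last spin `σ_N` (junk value `0` when `N = 0`). -/
def spinLast {N : ℕ} (σ : Config N) : ℝ :=
  if h : 0 < N then spin (σ ⟨N - 1, Nat.sub_lt h Nat.one_pos⟩) else 0

/-- The Gaussian disorder: i.i.d. standard Gaussians indexed by pairs `(i, j)`
(only the entries with `i < j` are used). -/
def gaussPi (N : ℕ) : Measure (Fin N × Fin N → ℝ) :=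
  Measure.pi fun _ => gaussianReal 0 1

instance (N : ℕ) : IsProbabilityMeasure (gaussPi N) := by
  unfold gaussPi; infer_instance

/-- Three independent copies `g, g', g''` of the disorder. -/
def disM3 (N : ℕ) :
    Measure ((Fin N × Fin N → ℝ) × (Fin N × Fin N → ℝ) × (Fin N × Fin N → ℝ)) :=
  (gaussPi N).prod ((gaussPi N).prod (gaussPi N))

/-- The SK Hamiltonian `H_{N,β}(σ) = (β/√N) ∑_{i<j} g_{ij} σ_i σ_j`. -/
def ham (N : ℕ) (β : ℝ) (g : Fin N × Fin N → ℝ) (σ : Config N) : ℝ :=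
  (β / Real.sqrt N) *
    ∑ p ∈ Finset.univ.filter (fun p : Fin N × Fin N => p.1 < p.2),
      g p * spin (σ p.1) * spin (σ p.2)

/-- The cavity Hamiltonian `H⁻_N(σ) = (β/√N) ∑_{i<j<N} g_{ij} σ_i σ_j` on the first
`N - 1` spins. -/
def hamCav (N : ℕ) (β : ℝ) (g : Fin N × Fin N → ℝ) (σ : Config N) : ℝ :=
  (β / Real.sqrt N) *
    ∑ p ∈ Finset.univ.filter
        (fun p : Fin N × Fin N => p.1 < p.2 ∧ (p.2 : ℕ) < N - 1),
      g p * spin (σ p.1) * spin (σ p.2)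

/-- The overlap `R(σ¹,σ²) = (1/N) ∑_{i ≤ N} σ_i¹ σ_i²`. -/
def ovlp (N : ℕ) (σ τ : Config N) : ℝ := (∑ i, spin (σ i) * spin (τ i)) / N

/-- The truncated overlap `R⁻(σ¹,σ²) = (1/N) ∑_{i ≤ N−1} σ_i¹ σ_i²`. -/
def ovlpm (N : ℕ) (σ τ : Config N) : ℝ :=
  (∑ i ∈ Finset.univ.filter (fun i : Fin N => (i : ℕ) < N - 1),
    spin (σ i) * spin (τ i)) / N

/-- The partition function `Z_N(β)`. -/
def partFun (N : ℕ) (β : ℝ) (g : Fin N × Fin N → ℝ) : ℝ :=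
  ∑ σ : Config N, Real.exp (ham N β g σ)

/-- The free energy `F_N(β) = ln Z_N(β)`. -/
def freeEnergy (N : ℕ) (β : ℝ) (g : Fin N × Fin N → ℝ) : ℝ :=
  Real.log (partFun N β g)

/-- Two-replica Gibbs average `⟨f⟩` for the single SK system. -/
def gibbs2 (N : ℕ) (β : ℝ) (g : Fin N × Fin N → ℝ)
    (f : Config N → Config N → ℝ) : ℝ :=
  (∑ σ : Config N, ∑ τ : Config N,
    f σ τ * Real.exp (ham N β g σ + ham N β g τ)) / (partFun N β g) ^ 2

/-- Disorder expectation of the two-replica Gibbs average. -/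
def Egibbs2 (N : ℕ) (β : ℝ) (f : Config N → Config N → ℝ) : ℝ :=
  ∫ g, gibbs2 N β g f ∂gaussPi N

/-- The interpolated Hamiltonian `√t · H_N + √(1−t) · H'_N`. -/
def hamT (N : ℕ) (β t : ℝ) (g g' : Fin N × Fin N → ℝ) (σ : Config N) : ℝ :=
  Real.sqrt t * ham N β g σ + Real.sqrt (1 - t) * ham N β g' σ

/-- The coupled Gibbs weight `exp(H¹_{N,t}(σ) + H²_{N,t}(τ))`. -/
def wT (N : ℕ) (β t : ℝ) (g g' g'' : Fin N × Fin N → ℝ)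
    (ρ : Config N × Config N) : ℝ :=
  Real.exp (hamT N β t g g' ρ.1 + hamT N β t g g'' ρ.2)

/-- The coupled Gibbs average `⟨f⟩_t` of a function of one pair `(σ, τ)`. -/
def gibbsT (N : ℕ) (β t : ℝ) (g g' g'' : Fin N × Fin N → ℝ)
    (f : Config N × Config N → ℝ) : ℝ :=
  (∑ ρ : Config N × Config N, f ρ * wT N β t g g' g'' ρ) /
    (∑ ρ : Config N × Config N, wT N β t g g' g'' ρ)

/-- The coupled Gibbs average `⟨f⟩_t` of a function of two pairs. -/
def gibbsT2 (N : ℕ) (β t : ℝ) (g g' g'' : Fin N × Fin N → ℝ)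
    (f : Config N × Config N → Config N × Config N → ℝ) : ℝ :=
  (∑ ρ₁ : Config N × Config N, ∑ ρ₂ : Config N × Config N,
    f ρ₁ ρ₂ * wT N β t g g' g'' ρ₁ * wT N β t g g' g'' ρ₂) /
    (∑ ρ : Config N × Config N, wT N β t g g' g'' ρ) ^ 2

/-- Disorder expectation `E⟨f⟩_t` (one pair). -/
def EgibbsT (N : ℕ) (β t : ℝ) (f : Config N × Config N → ℝ) : ℝ :=
  ∫ ω, gibbsT N β t ω.1 ω.2.1 ω.2.2 f ∂disM3 N

/-- Disorder expectation `E⟨f⟩_t` (two pairs). -/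
def EgibbsT2 (N : ℕ) (β t : ℝ)
    (f : Config N × Config N → Config N × Config N → ℝ) : ℝ :=
  ∫ ω, gibbsT2 N β t ω.1 ω.2.1 ω.2.2 f ∂disM3 N

/-- The `s`-dependent cavity field term
`(β/√N) σ_N ∑_{i<N} (√t g_{iN} + √(1−t) g'_{iN}) σ_i`. -/
def cavField (N : ℕ) (β t : ℝ) (g g' : Fin N × Fin N → ℝ) (σ : Config N) : ℝ :=
  if h : 0 < N then
    (β / Real.sqrt N) * spin (σ ⟨N - 1, Nat.sub_lt h Nat.one_pos⟩) *
      ∑ i ∈ Finset.univ.filter (fun i : Fin N => (i : ℕ) < N - 1),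
        (Real.sqrt t * g (i, ⟨N - 1, Nat.sub_lt h Nat.one_pos⟩) +
          Real.sqrt (1 - t) * g' (i, ⟨N - 1, Nat.sub_lt h Nat.one_pos⟩)) * spin (σ i)
  else 0

/-- The cavity-interpolated Hamiltonian `H^1_{N,t,s}` (resp. `H^2_{N,t,s}` with `g''`). -/
def hamTS (N : ℕ) (β t s : ℝ) (g g' : Fin N × Fin N → ℝ) (σ : Config N) : ℝ :=
  Real.sqrt t * hamCav N β g σ + Real.sqrt (1 - t) * hamCav N β g' σ +
    Real.sqrt s * cavField N β t g g' σ

/-- The coupled cavity Gibbs weight `exp(H¹_{N,t,s}(σ) + H²_{N,t,s}(τ))`. -/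
def wTS (N : ℕ) (β t s : ℝ) (g g' g'' : Fin N × Fin N → ℝ)
    (ρ : Config N × Config N) : ℝ :=
  Real.exp (hamTS N β t s g g' ρ.1 + hamTS N β t s g g'' ρ.2)

/-- The coupled cavity Gibbs average `⟨f⟩_{t,s}` of a function of one pair. -/
def gibbsTS1 (N : ℕ) (β t s : ℝ) (g g' g'' : Fin N × Fin N → ℝ)
    (f : Config N × Config N → ℝ) : ℝ :=
  (∑ ρ : Config N × Config N, f ρ * wTS N β t s g g' g'' ρ) /
    (∑ ρ : Config N × Config N, wTS N β t s g g' g'' ρ)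

/-- The coupled cavity Gibbs average `⟨f⟩_{t,s}` of a function of two pairs. -/
def gibbsTS2 (N : ℕ) (β t s : ℝ) (g g' g'' : Fin N × Fin N → ℝ)
    (f : Config N × Config N → Config N × Config N → ℝ) : ℝ :=
  (∑ ρ₁ : Config N × Config N, ∑ ρ₂ : Config N × Config N,
    f ρ₁ ρ₂ * wTS N β t s g g' g'' ρ₁ * wTS N β t s g g' g'' ρ₂) /
    (∑ ρ : Config N × Config N, wTS N β t s g g' g'' ρ) ^ 2

/-- The coupled cavity Gibbs average `⟨f⟩_{t,s}` of a function of `n` pairs. -/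
def gibbsTSn (N : ℕ) (β t s : ℝ) (g g' g'' : Fin N × Fin N → ℝ) {n : ℕ}
    (f : (Fin n → Config N × Config N) → ℝ) : ℝ :=
  (∑ ρ : Fin n → Config N × Config N, f ρ * ∏ l, wTS N β t s g g' g'' (ρ l)) /
    (∑ ρ₀ : Config N × Config N, wTS N β t s g g' g'' ρ₀) ^ n

/-- Disorder expectation `E⟨f⟩_{t,s}` (one pair). -/
def EgibbsTS1 (N : ℕ) (β t s : ℝ) (f : Config N × Config N → ℝ) : ℝ :=
  ∫ ω, gibbsTS1 N β t s ω.1 ω.2.1 ω.2.2 f ∂disM3 N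

/-- Disorder expectation `E⟨f⟩_{t,s}` (two pairs). -/
def EgibbsTS2 (N : ℕ) (β t s : ℝ)
    (f : Config N × Config N → Config N × Config N → ℝ) : ℝ :=
  ∫ ω, gibbsTS2 N β t s ω.1 ω.2.1 ω.2.2 f ∂disM3 N

/-- Disorder expectation `E⟨f⟩_{t,s}` (`n` pairs). -/
def EgibbsTSn (N : ℕ) (β t s : ℝ) {n : ℕ}
    (f : (Fin n → Config N × Config N) → ℝ) : ℝ :=
  ∫ ω, gibbsTSn N β t s ω.1 ω.2.1 ω.2.2 f ∂disM3 N

/-- The covariance kernel `U(ρ, ρ')` of the `s`-part of the coupled cavity Hamiltonians. -/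
def Ufun (N : ℕ) (β t : ℝ) (ρ ρ' : Config N × Config N) : ℝ :=
  β ^ 2 / 2 * (spinLast ρ.1 * spinLast ρ'.1 * ovlpm N ρ.1 ρ'.1 +
      spinLast ρ.2 * spinLast ρ'.2 * ovlpm N ρ.2 ρ'.2) +
    β ^ 2 * t / 2 * (spinLast ρ.1 * spinLast ρ'.2 * ovlpm N ρ.1 ρ'.2 +
      spinLast ρ.2 * spinLast ρ'.1 * ovlpm N ρ.2 ρ'.1)

/-- `ν(β) = −(1/2)·ln(1 − β²) − β²/2`. -/
def nuSK (b : ℝ) : ℝ := -(1 / 2) * Real.log (1 - b ^ 2) - b ^ 2 / 2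

section ReplicaAverage

variable {Ω P : Type*} [MeasurableSpace Ω] [Fintype P]

/-- The joint law of four replicas under the averaged product measure `E p^{⊗4}`. -/
def replicaWeight {Ω P : Type*} [MeasurableSpace Ω] (μ : Measure Ω) (p : P → Ω → ℝ)
    (q : P × P × P × P) : ℝ :=
  ∫ ω, p q.1 ω * p q.2.1 ω * p q.2.2.1 ω * p q.2.2.2 ω ∂μ

/-- The average `E⟨F⟩` of a function of four replicas. -/
def replicaAvg (μ : Measure Ω) (p : P → Ω → ℝ) (F : P × P × P × P → ℝ) : ℝ :=
  ∑ q, replicaWeight μ p q * F q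

/-- The average of a function of two replicas under the tilted weights `p · exp h`. -/
def tiltedAvg (μ : Measure Ω) (p h : P → Ω → ℝ) (f : P → P → ℝ) : ℝ :=
  ∫ ω, (∑ x, ∑ y, f x y * (p x ω * exp (h x ω)) * (p y ω * exp (h y ω))) /
    (∑ x, p x ω * exp (h x ω)) ^ 2 ∂μ

/-- A random probability vector `p` on a finite set together with an independent centred Gaussian
field `h` of covariance `κ`, where `κ x x = 2 L + 2 v x`; the permutations `Θ`, `θ` preserve `p`
and reverse the signs of `h`, `κ` and of `v`, respectively. -/
structure CavitySystem (μ : Measure Ω) (p h : P → Ω → ℝ) (κ : P → P → ℝ) (v : P → ℝ) (L : ℝ)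
    (Θ θ : P ≃ P) : Prop where
  nonneg : ∀ x ω, 0 ≤ p x ω
  sum_one : ∀ ω, ∑ x, p x ω = 1
  measurable_p : ∀ x, Measurable (p x)
  measurable_h : ∀ x, Measurable (h x)
  integrable : ∀ (x y z u : P) (a b c d : ℝ), Integrable (fun ω =>
    p x ω * p y ω * p z ω * p u ω *
      exp (a * h x ω + b * h y ω + c * h z ω + d * h u ω)) μ
  integral_eq : ∀ (x y z u : P) (a b c d : ℝ), ∫ ω,
    p x ω * p y ω * p z ω * p u ω *
      exp (a * h x ω + b * h y ω + c * h z ω + d * h u ω) ∂μ =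
    replicaWeight μ p (x, y, z, u) *
      exp ((a * a * κ x x + b * b * κ y y + c * c * κ z z + d * d * κ u u) / 2 +
        a * b * κ x y + a * c * κ x z + a * d * κ x u + b * c * κ y z + b * d * κ y u +
        c * d * κ z u)
  self : ∀ x, κ x x = 2 * L + 2 * v x
  L_le : L ≤ 1
  v_le : ∀ x, |v x| ≤ 1
  κ_le : ∀ x y, |κ x y| ≤ 4
  κ_comm : ∀ x y, κ x y = κ y x
  p_Θ : ∀ x ω, p (Θ x) ω = p x ω
  p_θ : ∀ x ω, p (θ x) ω = p x ω
  h_Θ : ∀ x ω, h (Θ x) ω = -h x ω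
  κ_Θ : ∀ x y, κ x (Θ y) = -κ x y
  v_θ : ∀ x, v (θ x) = -v x

section Avg

lemma replicaWeight_nonneg {Ω P : Type*} [MeasurableSpace Ω] {μ : Measure Ω} {p : P → Ω → ℝ}
    (hp : ∀ x ω, 0 ≤ p x ω) (q : P × P × P × P) : 0 ≤ replicaWeight μ p q :=
  integral_nonneg fun ω => by
    have h1 := hp q.1 ω
    have h2 := hp q.2.1 ω
    have h3 := hp q.2.2.1 ω
    have h4 := hp q.2.2.2 ω
    positivity

variable {μ : Measure Ω} {p : P → Ω → ℝ}

lemma replicaAvg_add (F G : P × P × P × P → ℝ) :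
    replicaAvg μ p (fun q => F q + G q) = replicaAvg μ p F + replicaAvg μ p G := by
  simp [replicaAvg, mul_add, Finset.sum_add_distrib]

lemma replicaAvg_const_mul (c : ℝ) (F : P × P × P × P → ℝ) :
    replicaAvg μ p (fun q => c * F q) = c * replicaAvg μ p F := by
  simp only [replicaAvg, Finset.mul_sum]
  exact Finset.sum_congr rfl fun q _ => by ring

lemma replicaAvg_mono (hp : ∀ x ω, 0 ≤ p x ω) {F G : P × P × P × P → ℝ} (h : ∀ q, F q ≤ G q) :
    replicaAvg μ p F ≤ replicaAvg μ p G :=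
  Finset.sum_le_sum fun q _ => mul_le_mul_of_nonneg_left (h q) (replicaWeight_nonneg hp q)

lemma replicaAvg_comp (e : P × P × P × P ≃ P × P × P × P)
    (he : ∀ q, replicaWeight μ p (e q) = replicaWeight μ p q) (F : P × P × P × P → ℝ) :
    replicaAvg μ p (fun q => F (e q)) = replicaAvg μ p F := by
  unfold replicaAvg
  rw [← Equiv.sum_comp e fun q => replicaWeight μ p q * F q]
  simp only [he]

lemma replicaAvg_eq_zero_of_odd (e : P × P × P × P ≃ P × P × P × P)
    (he : ∀ q, replicaWeight μ p (e q) = replicaWeight μ p q) (F : P × P × P × P → ℝ)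
    (hF : ∀ q, F (e q) = -F q) : replicaAvg μ p F = 0 := by
  have h1 := replicaAvg_comp e he F
  have h2 : replicaAvg μ p (fun q => F (e q)) = -replicaAvg μ p F := by
    simp [replicaAvg, hF]
  linarith

/-- Exchange the first and second replicas. -/
lemma replicaAvg_swap₁₂ (F : P × P × P × P → ℝ) :
    replicaAvg μ p (fun q => F (q.2.1, q.1, q.2.2)) = replicaAvg μ p F := by
  refine replicaAvg_comp ⟨fun q => (q.2.1, q.1, q.2.2), fun q => (q.2.1, q.1, q.2.2),
    fun _ => rfl, fun _ => rfl⟩ (fun q => ?_) F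
  unfold replicaWeight
  congr 1
  ext ω
  simp only [Equiv.coe_fn_mk]
  ring

/-- Exchange the second and third replicas. -/
lemma replicaAvg_swap₂₃ (F : P × P × P × P → ℝ) :
    replicaAvg μ p (fun q => F (q.1, q.2.2.1, q.2.1, q.2.2.2)) = replicaAvg μ p F := by
  refine replicaAvg_comp ⟨fun q => (q.1, q.2.2.1, q.2.1, q.2.2.2),
    fun q => (q.1, q.2.2.1, q.2.1, q.2.2.2), fun _ => rfl, fun _ => rfl⟩ (fun q => ?_) F
  unfold replicaWeight
  congr 1
  ext ω
  simp only [Equiv.coe_fn_mk]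
  ring

/-- Exchange the third and fourth replicas. -/
lemma replicaAvg_swap₃₄ (F : P × P × P × P → ℝ) :
    replicaAvg μ p (fun q => F (q.1, q.2.1, q.2.2.2, q.2.2.1)) = replicaAvg μ p F := by
  refine replicaAvg_comp ⟨fun q => (q.1, q.2.1, q.2.2.2, q.2.2.1),
    fun q => (q.1, q.2.1, q.2.2.2, q.2.2.1), fun _ => rfl, fun _ => rfl⟩ (fun q => ?_) F
  unfold replicaWeight
  congr 1
  ext ω
  simp only [Equiv.coe_fn_mk]
  ring

/-- Averages over one replica do not depend on its label. -/
lemma replicaAvg_single (f : P → ℝ) :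
    replicaAvg μ p (fun q => f q.2.1) = replicaAvg μ p (fun q => f q.1) ∧
    replicaAvg μ p (fun q => f q.2.2.1) = replicaAvg μ p (fun q => f q.1) ∧
    replicaAvg μ p (fun q => f q.2.2.2) = replicaAvg μ p (fun q => f q.1) := by
  have h1 := replicaAvg_swap₁₂ (μ := μ) (p := p) (fun q => f q.1)
  have h2 := replicaAvg_swap₂₃ (μ := μ) (p := p) (fun q => f q.2.1)
  have h3 := replicaAvg_swap₃₄ (μ := μ) (p := p) (fun q => f q.2.2.1)
  exact ⟨h1, h2.trans h1, h3.trans (h2.trans h1)⟩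

/-- Averages over two replicas do not depend on their labels. -/
lemma replicaAvg_pair (f : P → P → ℝ) :
    replicaAvg μ p (fun q => f q.1 q.2.2.1) = replicaAvg μ p (fun q => f q.1 q.2.1) ∧
    replicaAvg μ p (fun q => f q.1 q.2.2.2) = replicaAvg μ p (fun q => f q.1 q.2.1) ∧
    replicaAvg μ p (fun q => f q.2.1 q.2.2.1) = replicaAvg μ p (fun q => f q.1 q.2.1) ∧
    replicaAvg μ p (fun q => f q.2.1 q.2.2.2) = replicaAvg μ p (fun q => f q.1 q.2.1) ∧
    replicaAvg μ p (fun q => f q.2.2.1 q.2.2.2) = replicaAvg μ p (fun q => f q.1 q.2.1) := by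
  have h13 := replicaAvg_swap₂₃ (μ := μ) (p := p) (fun q => f q.1 q.2.1)
  have h14 := replicaAvg_swap₃₄ (μ := μ) (p := p) (fun q => f q.1 q.2.2.1)
  have h23 := replicaAvg_swap₁₂ (μ := μ) (p := p) (fun q => f q.1 q.2.2.1)
  have h24 := replicaAvg_swap₁₂ (μ := μ) (p := p) (fun q => f q.1 q.2.2.2)
  have h34 := replicaAvg_swap₂₃ (μ := μ) (p := p) (fun q => f q.2.1 q.2.2.2)
  refine ⟨h13, h14.trans h13, h23.trans h13, h24.trans (h14.trans h13),
    h34.trans (h24.trans (h14.trans h13))⟩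

end Avg

lemma abs_exp_sub_one_sub_self_le (x : ℝ) : |exp x - 1 - x| ≤ x ^ 2 * exp |x| := by
  have h := Complex.norm_exp_sub_sum_le_norm_mul_exp (x : ℂ) 2
  have e : Complex.exp x - ∑ m ∈ range 2, (x : ℂ) ^ m / (m.factorial : ℂ)
      = ((exp x - 1 - x : ℝ) : ℂ) := by
    simp [Finset.sum_range_succ]; ring
  rw [e, Complex.norm_real, Complex.norm_real] at h
  simpa using h

/-- Second-order expansion of `1 / Z²` around `Z = 1`. -/
lemma inv_sq_bounds {Z : ℝ} (hZ : exp (-1) ≤ Z) :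
    3 - 2 * Z ≤ 1 / Z ^ 2 ∧
      1 / Z ^ 2 ≤ 3 - 2 * Z + (2 * exp 1 + exp 1 ^ 2) * (1 - 2 * Z + Z ^ 2) := by
  have hpos : 0 < Z := (exp_pos _).trans_le hZ
  have hinv : 1 / Z ≤ exp 1 := by
    rw [div_le_iff₀ hpos]
    calc (1 : ℝ) = exp 1 * exp (-1) := by rw [← exp_add]; simp
      _ ≤ _ := mul_le_mul_of_nonneg_left hZ (exp_pos _).le
  have hinv0 : 0 < 1 / Z := by positivity
  have key : 1 / Z ^ 2 = 3 - 2 * Z + (2 * (1 / Z) + (1 / Z) ^ 2) * (Z - 1) ^ 2 := by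
    field_simp; ring
  rw [key]
  constructor
  · have : 0 ≤ (2 * (1 / Z) + (1 / Z) ^ 2) * (Z - 1) ^ 2 := by positivity
    linarith
  · have h2 : (1 / Z) ^ 2 ≤ exp 1 ^ 2 := pow_le_pow_left₀ hinv0.le hinv 2
    have : (2 * (1 / Z) + (1 / Z) ^ 2) * (Z - 1) ^ 2 ≤
        (2 * exp 1 + exp 1 ^ 2) * (Z - 1) ^ 2 :=
      mul_le_mul_of_nonneg_right (by linarith) (sq_nonneg _)
    nlinarith

end ReplicaAverage

section TiltedAverage

variable {Ω P : Type*} [MeasurableSpace Ω] [Fintype P]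

lemma sum_four_replicas (p h : P → ℝ) (f : P → P → ℝ) (a b c d : ℝ) :
    ∑ q : P × P × P × P, f q.1 q.2.1 * (p q.1 * p q.2.1 * p q.2.2.1 * p q.2.2.2 *
      exp (a * h q.1 + b * h q.2.1 + c * h q.2.2.1 + d * h q.2.2.2)) =
    (∑ x, ∑ y, f x y * (p x * exp (a * h x)) * (p y * exp (b * h y))) *
      (∑ z, p z * exp (c * h z)) * ∑ u, p u * exp (d * h u) := by
  simp only [Fintype.sum_prod_type]
  have : ∀ x y z u : P, f x y * (p x * p y * p z * p u *
      exp (a * h x + b * h y + c * h z + d * h u)) =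
      f x y * (p x * exp (a * h x)) * (p y * exp (b * h y)) * (p z * exp (c * h z)) *
        (p u * exp (d * h u)) := fun x y z u => by
    rw [exp_add, exp_add, exp_add]; ring
  simp only [this, ← Finset.mul_sum, ← Finset.sum_mul]

namespace CavitySystem

variable {μ : Measure Ω} {p h : P → Ω → ℝ} {κ : P → P → ℝ} {v : P → ℝ} {L : ℝ} {Θ θ : P ≃ P}

lemma integrable_sum (hS : CavitySystem μ p h κ v L Θ θ) (f : P → P → ℝ) (a b c d : ℝ) :
    Integrable (fun ω => (∑ x, ∑ y, f x y * (p x ω * exp (a * h x ω)) *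
      (p y ω * exp (b * h y ω))) * (∑ z, p z ω * exp (c * h z ω)) *
      ∑ u, p u ω * exp (d * h u ω)) μ := by
  simp only [← sum_four_replicas (fun x => p x _) (fun x => h x _)]
  exact integrable_finsetSum _ fun q _ => (hS.integrable _ _ _ _ a b c d).const_mul _

lemma integral_sum (hS : CavitySystem μ p h κ v L Θ θ) (f : P → P → ℝ) (a b c d : ℝ) :
    ∫ ω, (∑ x, ∑ y, f x y * (p x ω * exp (a * h x ω)) *
      (p y ω * exp (b * h y ω))) * (∑ z, p z ω * exp (c * h z ω)) *
      ∑ u, p u ω * exp (d * h u ω) ∂μ =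
    replicaAvg μ p fun q => f q.1 q.2.1 *
      exp ((a * a * κ q.1 q.1 + b * b * κ q.2.1 q.2.1 + c * c * κ q.2.2.1 q.2.2.1 +
        d * d * κ q.2.2.2 q.2.2.2) / 2 +
        a * b * κ q.1 q.2.1 + a * c * κ q.1 q.2.2.1 + a * d * κ q.1 q.2.2.2 +
        b * c * κ q.2.1 q.2.2.1 + b * d * κ q.2.1 q.2.2.2 + c * d * κ q.2.2.1 q.2.2.2) := by
  simp only [← sum_four_replicas (fun x => p x _) (fun x => h x _)]
  rw [integral_finsetSum _ fun q _ => (hS.integrable _ _ _ _ a b c d).const_mul _]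
  unfold replicaAvg
  refine Finset.sum_congr rfl fun q _ => ?_
  rw [integral_const_mul, hS.integral_eq]
  ring

lemma one_le_sum (hS : CavitySystem μ p h κ v L Θ θ) (ω : Ω) :
    1 ≤ ∑ x, p x ω * exp (h x ω) := by
  have h1 : ∑ x, p x ω * exp (h x ω) = ∑ x, p x ω * exp (-h x ω) := by
    rw [← Equiv.sum_comp Θ]
    simp only [hS.p_Θ, hS.h_Θ]
  have h2 : ∑ x, p x ω * 2 ≤ ∑ x, (p x ω * exp (h x ω) + p x ω * exp (-h x ω)) := by
    refine Finset.sum_le_sum fun x _ => ?_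
    rw [← mul_add]
    refine mul_le_mul_of_nonneg_left ?_ (hS.nonneg x ω)
    have := add_one_le_exp (h x ω)
    have := add_one_le_exp (-h x ω)
    linarith
  rw [Finset.sum_add_distrib, ← h1, ← Finset.sum_mul, hS.sum_one] at h2
  linarith

lemma integrable_tilted (hS : CavitySystem μ p h κ v L Θ θ) (f : P → P → ℝ) :
    Integrable (fun ω => (∑ x, ∑ y, f x y * (p x ω * exp (h x ω)) * (p y ω * exp (h y ω))) /
      (∑ x, p x ω * exp (h x ω)) ^ 2) μ := by
  have h0 := (hS.integrable_sum f 1 1 0 0).norm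
  have hp := hS.measurable_p
  have hh := hS.measurable_h
  refine h0.mono' (Measurable.aestronglyMeasurable (by fun_prop)) (.of_forall fun ω => ?_)
  simp only [one_mul, zero_mul, exp_zero, mul_one, hS.sum_one]
  rw [norm_div]
  refine div_le_self (norm_nonneg _) ?_
  rw [norm_pow]
  refine one_le_pow₀ ?_
  exact (hS.one_le_sum ω).trans (le_abs_self _)

/-- Nonnegative functions: the untilted average is controlled by the tilted one. -/
lemma replicaAvg_le_tiltedAvg (hS : CavitySystem μ p h κ v L Θ θ) {f : P → P → ℝ}
    (hf : ∀ x y, 0 ≤ f x y) :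
    replicaAvg μ p (fun q => f q.1 q.2.1) ≤ exp 12 * tiltedAvg μ p h f := by
  have hpoint : ∀ ω,
      2 * exp (-10) * ((∑ x, ∑ y, f x y * (p x ω * exp (1 / 2 * h x ω)) *
        (p y ω * exp (1 / 2 * h y ω))) * (∑ z, p z ω * exp (0 * h z ω)) *
        ∑ u, p u ω * exp (0 * h u ω)) -
      exp (-10) ^ 2 * ((∑ x, ∑ y, f x y * (p x ω * exp (0 * h x ω)) *
        (p y ω * exp (0 * h y ω))) * (∑ z, p z ω * exp (1 * h z ω)) *
        ∑ u, p u ω * exp (1 * h u ω)) ≤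
      (∑ x, ∑ y, f x y * (p x ω * exp (h x ω)) * (p y ω * exp (h y ω))) /
      (∑ x, p x ω * exp (h x ω)) ^ 2 := by
    intro ω
    simp only [one_mul, zero_mul, exp_zero, mul_one, hS.sum_one]
    set Z := ∑ x, p x ω * exp (h x ω)
    have hZ : 0 < Z := one_pos.trans_le (hS.one_le_sum ω)
    rw [mul_assoc _ Z Z]
    simp only [Finset.mul_sum, Finset.sum_mul, Finset.sum_div, ← Finset.sum_sub_distrib]
    refine Finset.sum_le_sum fun x _ => Finset.sum_le_sum fun y _ => ?_
    have hc : 0 ≤ f x y * p x ω * p y ω :=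
      mul_nonneg (mul_nonneg (hf x y) (hS.nonneg x ω)) (hS.nonneg y ω)
    have ex : exp (h x ω) = exp (1 / 2 * h x ω) ^ 2 := by rw [← exp_nat_mul]; congr 1; ring
    have ey : exp (h y ω) = exp (1 / 2 * h y ω) ^ 2 := by rw [← exp_nat_mul]; congr 1; ring
    have key : 0 ≤ (exp (1 / 2 * h x ω) * exp (1 / 2 * h y ω) / Z - exp (-10) * Z) ^ 2 :=
      sq_nonneg _
    have hid : f x y * (p x ω * exp (h x ω)) * (p y ω * exp (h y ω)) / Z ^ 2 -
        (2 * exp (-10) * (f x y * (p x ω * exp (1 / 2 * h x ω)) * (p y ω * exp (1 / 2 * h y ω))) -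
          exp (-10) ^ 2 * (f x y * p x ω * p y ω * (Z * Z))) =
        (f x y * p x ω * p y ω) *
          (exp (1 / 2 * h x ω) * exp (1 / 2 * h y ω) / Z - exp (-10) * Z) ^ 2 := by
      rw [ex, ey]
      field_simp
      ring
    have := mul_nonneg hc key
    linarith
  have hle := integral_mono
    (((hS.integrable_sum f (1 / 2) (1 / 2) 0 0).const_mul (2 * exp (-10))).sub
      ((hS.integrable_sum f 0 0 1 1).const_mul (exp (-10) ^ 2))) (hS.integrable_tilted f) hpoint
  rw [integral_sub' ((hS.integrable_sum f (1 / 2) (1 / 2) 0 0).const_mul (2 * exp (-10)))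
      ((hS.integrable_sum f 0 0 1 1).const_mul (exp (-10) ^ 2)), integral_const_mul,
    integral_const_mul, hS.integral_sum, hS.integral_sum] at hle
  have hlow : exp (-2) * replicaAvg μ p (fun q => f q.1 q.2.1) ≤
      replicaAvg μ p fun q => f q.1 q.2.1 * exp ((1 / 2 * (1 / 2) * κ q.1 q.1 +
        1 / 2 * (1 / 2) * κ q.2.1 q.2.1 + 0 * 0 * κ q.2.2.1 q.2.2.1 +
        0 * 0 * κ q.2.2.2 q.2.2.2) / 2 +
        1 / 2 * (1 / 2) * κ q.1 q.2.1 + 1 / 2 * 0 * κ q.1 q.2.2.1 + 1 / 2 * 0 * κ q.1 q.2.2.2 +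
        1 / 2 * 0 * κ q.2.1 q.2.2.1 + 1 / 2 * 0 * κ q.2.1 q.2.2.2 +
        0 * 0 * κ q.2.2.1 q.2.2.2) := by
    rw [← replicaAvg_const_mul]
    refine replicaAvg_mono hS.nonneg fun q => ?_
    rw [mul_comm (exp (-2))]
    refine mul_le_mul_of_nonneg_left (exp_le_exp.mpr ?_) (hf _ _)
    have h1 := (abs_le.mp (hS.κ_le q.1 q.1)).1
    have h2 := (abs_le.mp (hS.κ_le q.2.1 q.2.1)).1
    have h3 := (abs_le.mp (hS.κ_le q.1 q.2.1)).1
    linarith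
  have hup : (replicaAvg μ p fun q => f q.1 q.2.1 *
      exp ((0 * 0 * κ q.1 q.1 + 0 * 0 * κ q.2.1 q.2.1 +
        1 * 1 * κ q.2.2.1 q.2.2.1 + 1 * 1 * κ q.2.2.2 q.2.2.2) / 2 +
        0 * 0 * κ q.1 q.2.1 + 0 * 1 * κ q.1 q.2.2.1 + 0 * 1 * κ q.1 q.2.2.2 +
        0 * 1 * κ q.2.1 q.2.2.1 + 0 * 1 * κ q.2.1 q.2.2.2 +
        1 * 1 * κ q.2.2.1 q.2.2.2)) ≤ exp 8 * replicaAvg μ p (fun q => f q.1 q.2.1) := by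
    rw [← replicaAvg_const_mul]
    refine replicaAvg_mono hS.nonneg fun q => ?_
    rw [mul_comm (exp 8)]
    refine mul_le_mul_of_nonneg_left (exp_le_exp.mpr ?_) (hf _ _)
    have h1 := (abs_le.mp (hS.κ_le q.2.2.1 q.2.2.1)).2
    have h2 := (abs_le.mp (hS.κ_le q.2.2.2 q.2.2.2)).2
    have h3 := (abs_le.mp (hS.κ_le q.2.2.1 q.2.2.2)).2
    linarith
  have e1 : exp (-10) * exp (-2) = exp (-12) := by rw [← exp_add]; norm_num
  have e2 : exp (-10) ^ 2 * exp 8 = exp (-12) := by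
    rw [← exp_nat_mul, ← exp_add]; norm_num
  have e3 : exp 12 * exp (-12) = 1 := by rw [← exp_add]; norm_num
  have hlow' := mul_le_mul_of_nonneg_left hlow (show 0 ≤ 2 * exp (-10) by positivity)
  have hup' := mul_le_mul_of_nonneg_left hup (show 0 ≤ exp (-10) ^ 2 by positivity)
  rw [← mul_assoc, mul_assoc 2, e1] at hlow'
  rw [← mul_assoc, e2] at hup'
  have hfin : exp (-12) * replicaAvg μ p (fun q => f q.1 q.2.1) ≤ tiltedAvg μ p h f := by
    unfold tiltedAvg
    linarith
  have := mul_le_mul_of_nonneg_left hfin (exp_pos 12).le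
  rwa [← mul_assoc, e3, one_mul] at this

end CavitySystem
end TiltedAverage

section SecondOrderExpansion

variable {Ω P : Type*} [MeasurableSpace Ω] [Fintype P]

/-- Normalised log-Laplace exponent of two replicas. -/
def exponent₂ (κ : P → P → ℝ) (v : P → ℝ) (q : P × P × P × P) : ℝ :=
  v q.1 + v q.2.1 + κ q.1 q.2.1

/-- Normalised log-Laplace exponent of three replicas. -/
def exponent₃ (κ : P → P → ℝ) (v : P → ℝ) (q : P × P × P × P) : ℝ :=
  exponent₂ κ v q + v q.2.2.1 + κ q.1 q.2.2.1 + κ q.2.1 q.2.2.1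

/-- Normalised log-Laplace exponent of four replicas. -/
def exponent₄ (κ : P → P → ℝ) (v : P → ℝ) (q : P × P × P × P) : ℝ :=
  exponent₃ κ v q + v q.2.2.2 + κ q.1 q.2.2.2 + κ q.2.1 q.2.2.2 + κ q.2.2.1 q.2.2.2

/-- The sum of the squares of all the terms of the exponents. -/
def exponentSq (κ : P → P → ℝ) (v : P → ℝ) (q : P × P × P × P) : ℝ :=
  v q.1 ^ 2 + v q.2.1 ^ 2 + v q.2.2.1 ^ 2 + v q.2.2.2 ^ 2 + κ q.1 q.2.1 ^ 2 +
    κ q.1 q.2.2.1 ^ 2 + κ q.1 q.2.2.2 ^ 2 + κ q.2.1 q.2.2.1 ^ 2 + κ q.2.1 q.2.2.2 ^ 2 +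
    κ q.2.2.1 q.2.2.2 ^ 2

namespace CavitySystem

variable {μ : Measure Ω} {p h : P → Ω → ℝ} {κ : P → P → ℝ} {v : P → ℝ} {L : ℝ} {Θ θ : P ≃ P}

lemma integral_sum₂ (hS : CavitySystem μ p h κ v L Θ θ) (f : P → P → ℝ) :
    exp (-(2 * L)) * ∫ ω, (∑ x, ∑ y, f x y * (p x ω * exp (1 * h x ω)) *
      (p y ω * exp (1 * h y ω))) * (∑ z, p z ω * exp (0 * h z ω)) *
      ∑ u, p u ω * exp (0 * h u ω) ∂μ =
    replicaAvg μ p fun q => f q.1 q.2.1 * exp (exponent₂ κ v q) := by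
  rw [hS.integral_sum, ← replicaAvg_const_mul]
  congr 1
  ext q
  rw [mul_left_comm, ← exp_add]
  congr 2
  simp only [hS.self, exponent₂]
  ring

lemma integral_sum₃ (hS : CavitySystem μ p h κ v L Θ θ) (f : P → P → ℝ) :
    exp (-(3 * L)) * ∫ ω, (∑ x, ∑ y, f x y * (p x ω * exp (1 * h x ω)) *
      (p y ω * exp (1 * h y ω))) * (∑ z, p z ω * exp (1 * h z ω)) *
      ∑ u, p u ω * exp (0 * h u ω) ∂μ =
    replicaAvg μ p fun q => f q.1 q.2.1 * exp (exponent₃ κ v q) := by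
  rw [hS.integral_sum, ← replicaAvg_const_mul]
  congr 1
  ext q
  rw [mul_left_comm, ← exp_add]
  congr 2
  simp only [hS.self, exponent₂, exponent₃]
  ring

lemma integral_sum₄ (hS : CavitySystem μ p h κ v L Θ θ) (f : P → P → ℝ) :
    exp (-(4 * L)) * ∫ ω, (∑ x, ∑ y, f x y * (p x ω * exp (1 * h x ω)) *
      (p y ω * exp (1 * h y ω))) * (∑ z, p z ω * exp (1 * h z ω)) *
      ∑ u, p u ω * exp (1 * h u ω) ∂μ =
    replicaAvg μ p fun q => f q.1 q.2.1 * exp (exponent₄ κ v q) := by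
  rw [hS.integral_sum, ← replicaAvg_const_mul]
  congr 1
  ext q
  rw [mul_left_comm, ← exp_add]
  congr 2
  simp only [hS.self, exponent₂, exponent₃, exponent₄]
  ring

/-- Two-sided polynomial comparison for the tilted average, integrated over the Gaussian field. -/
lemma tiltedAvg_bounds (hS : CavitySystem μ p h κ v L Θ θ) {f : P → P → ℝ}
    (hf : ∀ x y, 0 ≤ f x y) :
    3 * replicaAvg μ p (fun q => f q.1 q.2.1 * exp (exponent₂ κ v q)) -
      2 * replicaAvg μ p (fun q => f q.1 q.2.1 * exp (exponent₃ κ v q)) ≤ tiltedAvg μ p h f ∧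
    tiltedAvg μ p h f ≤
      3 * replicaAvg μ p (fun q => f q.1 q.2.1 * exp (exponent₂ κ v q)) -
      2 * replicaAvg μ p (fun q => f q.1 q.2.1 * exp (exponent₃ κ v q)) +
      (2 * exp 1 + exp 1 ^ 2) *
        (replicaAvg μ p (fun q => f q.1 q.2.1 * exp (exponent₂ κ v q)) -
        2 * replicaAvg μ p (fun q => f q.1 q.2.1 * exp (exponent₃ κ v q)) +
        replicaAvg μ p (fun q => f q.1 q.2.1 * exp (exponent₄ κ v q))) := by
  rw [← hS.integral_sum₂, ← hS.integral_sum₃, ← hS.integral_sum₄]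
  have i₂ := (hS.integrable_sum f 1 1 0 0)
  have i₃ := (hS.integrable_sum f 1 1 1 0)
  have i₄ := (hS.integrable_sum f 1 1 1 1)
  set n₂ := fun ω => (∑ x, ∑ y, f x y * (p x ω * exp (1 * h x ω)) *
      (p y ω * exp (1 * h y ω))) * (∑ z, p z ω * exp (0 * h z ω)) *
      ∑ u, p u ω * exp (0 * h u ω) with hn₂
  set n₃ := fun ω => (∑ x, ∑ y, f x y * (p x ω * exp (1 * h x ω)) *
      (p y ω * exp (1 * h y ω))) * (∑ z, p z ω * exp (1 * h z ω)) *
      ∑ u, p u ω * exp (0 * h u ω) with hn₃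
  set n₄ := fun ω => (∑ x, ∑ y, f x y * (p x ω * exp (1 * h x ω)) *
      (p y ω * exp (1 * h y ω))) * (∑ z, p z ω * exp (1 * h z ω)) *
      ∑ u, p u ω * exp (1 * h u ω) with hn₄
  have hpoint : ∀ ω,
      3 * exp (-(2 * L)) * n₂ ω - 2 * exp (-(3 * L)) * n₃ ω ≤
        (∑ x, ∑ y, f x y * (p x ω * exp (h x ω)) * (p y ω * exp (h y ω))) /
          (∑ x, p x ω * exp (h x ω)) ^ 2 ∧
      (∑ x, ∑ y, f x y * (p x ω * exp (h x ω)) * (p y ω * exp (h y ω))) /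
          (∑ x, p x ω * exp (h x ω)) ^ 2 ≤
        (3 + (2 * exp 1 + exp 1 ^ 2)) * exp (-(2 * L)) * n₂ ω -
          (2 + 2 * (2 * exp 1 + exp 1 ^ 2)) * exp (-(3 * L)) * n₃ ω +
          (2 * exp 1 + exp 1 ^ 2) * exp (-(4 * L)) * n₄ ω := by
    intro ω
    simp only [hn₂, hn₃, hn₄, one_mul, zero_mul, exp_zero, mul_one, hS.sum_one]
    have hZ := hS.one_le_sum ω
    set Z := ∑ x, p x ω * exp (h x ω)
    set n := ∑ x, ∑ y, f x y * (p x ω * exp (h x ω)) * (p y ω * exp (h y ω))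
    have hn : 0 ≤ n := Finset.sum_nonneg fun x _ => Finset.sum_nonneg fun y _ =>
      mul_nonneg (mul_nonneg (hf x y) (mul_nonneg (hS.nonneg x ω) (exp_pos _).le))
        (mul_nonneg (hS.nonneg y ω) (exp_pos _).le)
    have hL : exp (-1) ≤ Z * exp (-L) := by
      have : exp (-1) ≤ exp (-L) := exp_le_exp.mpr (by linarith [hS.L_le])
      nlinarith [exp_pos (-L)]
    obtain ⟨h1, h2⟩ := inv_sq_bounds hL
    have e2 : exp (-(2 * L)) = exp (-L) ^ 2 := by rw [← exp_nat_mul]; congr 1; push_cast; ring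
    have e3 : exp (-(3 * L)) = exp (-L) ^ 3 := by rw [← exp_nat_mul]; congr 1; push_cast; ring
    have e4 : exp (-(4 * L)) = exp (-L) ^ 4 := by rw [← exp_nat_mul]; congr 1; push_cast; ring
    rw [e2, e3, e4]
    have hc : 0 < exp (-L) := exp_pos _
    set c := exp (-L)
    have hn' : 0 ≤ n * c ^ 2 := by positivity
    have hZ0 : 0 < Z := one_pos.trans_le hZ
    have hid : n / Z ^ 2 = n * c ^ 2 * (1 / (Z * c) ^ 2) := by field_simp
    rw [hid]
    have h1' := mul_le_mul_of_nonneg_left h1 hn'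
    have h2' := mul_le_mul_of_nonneg_left h2 hn'
    constructor
    · linarith
    · linarith
  have m2 := i₂.const_mul (3 * exp (-(2 * L)))
  have m3 := i₃.const_mul (2 * exp (-(3 * L)))
  have m2' := i₂.const_mul ((3 + (2 * exp 1 + exp 1 ^ 2)) * exp (-(2 * L)))
  have m3' := i₃.const_mul ((2 + 2 * (2 * exp 1 + exp 1 ^ 2)) * exp (-(3 * L)))
  have m4' := i₄.const_mul ((2 * exp 1 + exp 1 ^ 2) * exp (-(4 * L)))
  have l1 := integral_mono (m2.sub m3) (hS.integrable_tilted f) fun ω => (hpoint ω).1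
  have l2 := integral_mono (hS.integrable_tilted f) ((m2'.sub m3').add m4')
    fun ω => (hpoint ω).2
  rw [integral_sub' m2 m3, integral_const_mul, integral_const_mul] at l1
  rw [integral_add' (m2'.sub m3') m4', integral_sub' m2' m3', integral_const_mul,
    integral_const_mul, integral_const_mul] at l2
  unfold tiltedAvg
  constructor <;> linarith

lemma exponent_bounds (hS : CavitySystem μ p h κ v L Θ θ) (q : P × P × P × P) :
    (|exponent₂ κ v q| ≤ 28 ∧ exponent₂ κ v q ^ 2 ≤ 10 * exponentSq κ v q) ∧
    (|exponent₃ κ v q| ≤ 28 ∧ exponent₃ κ v q ^ 2 ≤ 10 * exponentSq κ v q) ∧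
    (|exponent₄ κ v q| ≤ 28 ∧ exponent₄ κ v q ^ 2 ≤ 10 * exponentSq κ v q) := by
  have sq : ∀ a₁ a₂ a₃ a₄ a₅ a₆ a₇ a₈ a₉ a₁₀ : ℝ,
      (a₁ + a₂ + a₅ + a₃ + a₆ + a₈ + a₄ + a₇ + a₉ + a₁₀) ^ 2 ≤
      10 * (a₁ ^ 2 + a₂ ^ 2 + a₃ ^ 2 + a₄ ^ 2 + a₅ ^ 2 + a₆ ^ 2 + a₇ ^ 2 + a₈ ^ 2 + a₉ ^ 2 +
        a₁₀ ^ 2) := by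
    intro a₁ a₂ a₃ a₄ a₅ a₆ a₇ a₈ a₉ a₁₀
    have := sq_sum_le_card_mul_sum_sq (s := (univ : Finset (Fin 10)))
      (f := ![a₁, a₂, a₅, a₃, a₆, a₈, a₄, a₇, a₉, a₁₀])
    simp [Fin.sum_univ_succ] at this
    linarith
  have v1 := abs_le.mp (hS.v_le q.1)
  have v2 := abs_le.mp (hS.v_le q.2.1)
  have v3 := abs_le.mp (hS.v_le q.2.2.1)
  have v4 := abs_le.mp (hS.v_le q.2.2.2)
  have k12 := abs_le.mp (hS.κ_le q.1 q.2.1)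
  have k13 := abs_le.mp (hS.κ_le q.1 q.2.2.1)
  have k14 := abs_le.mp (hS.κ_le q.1 q.2.2.2)
  have k23 := abs_le.mp (hS.κ_le q.2.1 q.2.2.1)
  have k24 := abs_le.mp (hS.κ_le q.2.1 q.2.2.2)
  have k34 := abs_le.mp (hS.κ_le q.2.2.1 q.2.2.2)
  simp only [exponent₂, exponent₃, exponent₄, exponentSq]
  refine ⟨⟨abs_le.mpr ⟨by linarith, by linarith⟩, ?_⟩, ⟨abs_le.mpr ⟨by linarith, by linarith⟩, ?_⟩,
    ⟨abs_le.mpr ⟨by linarith, by linarith⟩, sq _ _ _ _ _ _ _ _ _ _⟩⟩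
  · have := sq (v q.1) (v q.2.1) 0 0 (κ q.1 q.2.1) 0 0 0 0 0
    simp only [add_zero] at this
    nlinarith [sq_nonneg (v q.2.2.1), sq_nonneg (v q.2.2.2), sq_nonneg (κ q.1 q.2.2.1),
      sq_nonneg (κ q.1 q.2.2.2), sq_nonneg (κ q.2.1 q.2.2.1), sq_nonneg (κ q.2.1 q.2.2.2),
      sq_nonneg (κ q.2.2.1 q.2.2.2)]
  · have := sq (v q.1) (v q.2.1) (v q.2.2.1) 0 (κ q.1 q.2.1) (κ q.1 q.2.2.1) 0
      (κ q.2.1 q.2.2.1) 0 0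
    simp only [add_zero] at this
    nlinarith [sq_nonneg (v q.2.2.2), sq_nonneg (κ q.1 q.2.2.2), sq_nonneg (κ q.2.1 q.2.2.2),
      sq_nonneg (κ q.2.2.1 q.2.2.2)]

/-- The average of the linear part of each exponent reduces to that of `v` at the second replica. -/
lemma replicaAvg_linear (hS : CavitySystem μ p h κ v L Θ θ) {f : P → P → ℝ}
    (fΘ : ∀ x y, f (Θ x) y = f x y) (fθ : ∀ x y, f (θ x) y = f x y) :
    replicaAvg μ p (fun q => f q.1 q.2.1 * exponent₂ κ v q) =
      replicaAvg μ p (fun q => f q.1 q.2.1 * v q.2.1) ∧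
    replicaAvg μ p (fun q => f q.1 q.2.1 * exponent₃ κ v q) =
      replicaAvg μ p (fun q => f q.1 q.2.1 * v q.2.1) ∧
    replicaAvg μ p (fun q => f q.1 q.2.1 * exponent₄ κ v q) =
      replicaAvg μ p (fun q => f q.1 q.2.1 * v q.2.1) := by
  let e₁ (e : P ≃ P) : P × P × P × P ≃ P × P × P × P := Equiv.prodCongr e (Equiv.refl _)
  let e₃ (e : P ≃ P) : P × P × P × P ≃ P × P × P × P :=
    Equiv.prodCongr (Equiv.refl _) (Equiv.prodCongr (Equiv.refl _)
      (Equiv.prodCongr e (Equiv.refl _)))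
  let e₄ (e : P ≃ P) : P × P × P × P ≃ P × P × P × P :=
    Equiv.prodCongr (Equiv.refl _) (Equiv.prodCongr (Equiv.refl _)
      (Equiv.prodCongr (Equiv.refl _) e))
  have hκ : ∀ x y, κ (Θ x) y = -κ x y := fun x y => by
    rw [hS.κ_comm, hS.κ_Θ, hS.κ_comm]
  have w₁ : ∀ e : P ≃ P, (∀ x ω, p (e x) ω = p x ω) →
      ∀ q, replicaWeight μ p (e₁ e q) = replicaWeight μ p q := fun e he q => by
    simp [replicaWeight, e₁, he]
  have w₃ : ∀ e : P ≃ P, (∀ x ω, p (e x) ω = p x ω) →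
      ∀ q, replicaWeight μ p (e₃ e q) = replicaWeight μ p q := fun e he q => by
    simp [replicaWeight, e₃, he]
  have w₄ : ∀ e : P ≃ P, (∀ x ω, p (e x) ω = p x ω) →
      ∀ q, replicaWeight μ p (e₄ e q) = replicaWeight μ p q := fun e he q => by
    simp [replicaWeight, e₄, he]
  have z1 := replicaAvg_eq_zero_of_odd (e₁ θ) (w₁ θ hS.p_θ)
    (fun q => f q.1 q.2.1 * v q.1) fun q => by simp [e₁, fθ, hS.v_θ]
  have z12 := replicaAvg_eq_zero_of_odd (e₁ Θ) (w₁ Θ hS.p_Θ)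
    (fun q => f q.1 q.2.1 * κ q.1 q.2.1) fun q => by simp [e₁, fΘ, hκ]
  have z3 := replicaAvg_eq_zero_of_odd (e₃ θ) (w₃ θ hS.p_θ)
    (fun q => f q.1 q.2.1 * v q.2.2.1) fun q => by simp [e₃, hS.v_θ]
  have z13 := replicaAvg_eq_zero_of_odd (e₃ Θ) (w₃ Θ hS.p_Θ)
    (fun q => f q.1 q.2.1 * κ q.1 q.2.2.1) fun q => by simp [e₃, hS.κ_Θ]
  have z23 := replicaAvg_eq_zero_of_odd (e₃ Θ) (w₃ Θ hS.p_Θ)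
    (fun q => f q.1 q.2.1 * κ q.2.1 q.2.2.1) fun q => by simp [e₃, hS.κ_Θ]
  have z4 := replicaAvg_eq_zero_of_odd (e₄ θ) (w₄ θ hS.p_θ)
    (fun q => f q.1 q.2.1 * v q.2.2.2) fun q => by simp [e₄, hS.v_θ]
  have z14 := replicaAvg_eq_zero_of_odd (e₄ Θ) (w₄ Θ hS.p_Θ)
    (fun q => f q.1 q.2.1 * κ q.1 q.2.2.2) fun q => by simp [e₄, hS.κ_Θ]
  have z24 := replicaAvg_eq_zero_of_odd (e₄ Θ) (w₄ Θ hS.p_Θ)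
    (fun q => f q.1 q.2.1 * κ q.2.1 q.2.2.2) fun q => by simp [e₄, hS.κ_Θ]
  have z34 := replicaAvg_eq_zero_of_odd (e₄ Θ) (w₄ Θ hS.p_Θ)
    (fun q => f q.1 q.2.1 * κ q.2.2.1 q.2.2.2) fun q => by simp [e₄, hS.κ_Θ]
  simp only [exponent₂, exponent₃, exponent₄, mul_add, replicaAvg_add, z1, z12, z3, z13, z23,
    z4, z14, z24, z34]
  simp

/-- Second-order comparison of the tilted and the untilted average. -/
lemma abs_tiltedAvg_sub_le (hS : CavitySystem μ p h κ v L Θ θ) {f : P → P → ℝ}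
    (hf : ∀ x y, 0 ≤ f x y) (fΘ : ∀ x y, f (Θ x) y = f x y) (fθ : ∀ x y, f (θ x) y = f x y) :
    |tiltedAvg μ p h f - replicaAvg μ p (fun q => f q.1 q.2.1) -
        replicaAvg μ p (fun q => f q.1 q.2.1 * v q.2.1)| ≤
      (5 + 4 * (2 * exp 1 + exp 1 ^ 2)) * (10 * exp 28) *
        replicaAvg μ p (fun q => f q.1 q.2.1 * exponentSq κ v q) := by
  have main : ∀ T : P × P × P × P → ℝ, (∀ q, |T q| ≤ 28 ∧ T q ^ 2 ≤ 10 * exponentSq κ v q) →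
      replicaAvg μ p (fun q => f q.1 q.2.1 * T q) =
        replicaAvg μ p (fun q => f q.1 q.2.1 * v q.2.1) →
      |replicaAvg μ p (fun q => f q.1 q.2.1 * exp (T q)) -
        (replicaAvg μ p (fun q => f q.1 q.2.1) +
          replicaAvg μ p (fun q => f q.1 q.2.1 * v q.2.1))| ≤
        (10 * exp 28) * replicaAvg μ p (fun q => f q.1 q.2.1 * exponentSq κ v q) := by
    intro T hT hlin
    have hq : ∀ q, |exp (T q) - 1 - T q| ≤ 10 * exp 28 * exponentSq κ v q := fun q => by
      have h0 : 0 ≤ exponentSq κ v q := by unfold exponentSq; positivity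
      refine (abs_exp_sub_one_sub_self_le _).trans ?_
      calc T q ^ 2 * exp |T q| ≤ (10 * exponentSq κ v q) * exp 28 :=
            mul_le_mul (hT q).2 (exp_le_exp.mpr (hT q).1) (exp_pos _).le (by positivity)
        _ = _ := by ring
    rw [← hlin, ← replicaAvg_add, ← replicaAvg_const_mul, abs_le]
    constructor
    · rw [neg_le_sub_iff_le_add, ← replicaAvg_add]
      refine replicaAvg_mono hS.nonneg fun q => ?_
      have := mul_le_mul_of_nonneg_left (abs_le.mp (hq q)).1 (hf q.1 q.2.1)
      linarith
    · rw [sub_le_iff_le_add, ← replicaAvg_add]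
      refine replicaAvg_mono hS.nonneg fun q => ?_
      have := mul_le_mul_of_nonneg_left (abs_le.mp (hq q)).2 (hf q.1 q.2.1)
      linarith
  obtain ⟨l2, l3, l4⟩ := hS.replicaAvg_linear fΘ fθ
  have m2 := abs_le.mp (main _ (fun q => (hS.exponent_bounds q).1) l2)
  have m3 := abs_le.mp (main _ (fun q => (hS.exponent_bounds q).2.1) l3)
  have m4 := abs_le.mp (main _ (fun q => (hS.exponent_bounds q).2.2) l4)
  obtain ⟨b1, b2⟩ := hS.tiltedAvg_bounds hf
  set E := 10 * exp 28 * replicaAvg μ p (fun q => f q.1 q.2.1 * exponentSq κ v q) with hE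
  have hE0 : 0 ≤ E := by linarith [m2.1, m2.2]
  have hk : 0 < 2 * exp 1 + exp 1 ^ 2 := by positivity
  set k := 2 * exp 1 + exp 1 ^ 2
  rw [mul_assoc (5 + 4 * k), ← hE, abs_le]
  constructor
  · nlinarith
  · have : replicaAvg μ p (fun q => f q.1 q.2.1 * exp (exponent₂ κ v q)) -
        2 * replicaAvg μ p (fun q => f q.1 q.2.1 * exp (exponent₃ κ v q)) +
        replicaAvg μ p (fun q => f q.1 q.2.1 * exp (exponent₄ κ v q)) ≤ 4 * E := by linarith
    have := mul_le_mul_of_nonneg_left this hk.le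
    linarith

/-- The quadratic error term, split by Young's inequality. -/
lemma replicaAvg_exponentSq_le (hS : CavitySystem μ p h κ v L Θ θ) {f : P → P → ℝ}
    (hf : ∀ x y, 0 ≤ f x y) {l : ℝ} (hl : 0 < l) :
    replicaAvg μ p (fun q => f q.1 q.2.1 * exponentSq κ v q) ≤
      10 * (l * replicaAvg μ p (fun q => f q.1 q.2.1) +
        l⁻¹ * (replicaAvg μ p (fun q => f q.1 q.2.1 ^ 2) +
          replicaAvg μ p (fun q => κ q.1 q.2.1 ^ 8) + replicaAvg μ p (fun q => v q.1 ^ 8))) := by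
  have young : ∀ a b : ℝ, 0 ≤ a → a * b ^ 2 ≤ l * a + l⁻¹ * (a ^ 2 + b ^ 8) := by
    intro a b ha
    have h1 : a * b ^ 2 ≤ l * a + l⁻¹ * (a * b ^ 4) := by
      have : l * a + l⁻¹ * (a * b ^ 4) - a * b ^ 2 =
          a * l⁻¹ * ((l - b ^ 2 / 2) ^ 2 + 3 / 4 * b ^ 4) := by field_simp; ring
      have h2 : 0 ≤ a * l⁻¹ * ((l - b ^ 2 / 2) ^ 2 + 3 / 4 * b ^ 4) := by positivity
      linarith
    have h2 : a * b ^ 4 ≤ a ^ 2 + b ^ 8 := by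
      nlinarith [sq_nonneg (a - b ^ 4 / 2), sq_nonneg (b ^ 4)]
    have := mul_le_mul_of_nonneg_left h2 (inv_pos.mpr hl).le
    linarith
  have avg : ∀ b : P × P × P × P → ℝ, replicaAvg μ p (fun q => f q.1 q.2.1 * b q ^ 2) ≤
      l * replicaAvg μ p (fun q => f q.1 q.2.1) +
        l⁻¹ * (replicaAvg μ p (fun q => f q.1 q.2.1 ^ 2) + replicaAvg μ p (fun q => b q ^ 8)) := by
    intro b
    rw [← replicaAvg_add, ← replicaAvg_const_mul, ← replicaAvg_const_mul, ← replicaAvg_add]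
    exact replicaAvg_mono hS.nonneg fun q => young _ _ (hf _ _)
  have hv := replicaAvg_mono (μ := μ) hS.nonneg (F := fun _ => 0) (G := fun q => v q.1 ^ 8)
    fun q => by positivity
  have hκ := replicaAvg_mono (μ := μ) hS.nonneg (F := fun _ => 0)
    (G := fun q => κ q.1 q.2.1 ^ 8) fun q => by positivity
  have h0 : replicaAvg μ p (fun _ => 0) = 0 := by simp [replicaAvg]
  rw [h0] at hv hκ
  have hv' := mul_nonneg (inv_pos.mpr hl).le hv
  have hκ' := mul_nonneg (inv_pos.mpr hl).le hκ
  obtain ⟨s2, s3, s4⟩ := replicaAvg_single (μ := μ) (p := p) (fun x => v x ^ 8)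
  obtain ⟨s13, s14, s23, s24, s34⟩ := replicaAvg_pair (μ := μ) (p := p) (fun x y => κ x y ^ 8)
  have a1 := avg fun q => v q.1
  have a2 := avg fun q => v q.2.1
  have a3 := avg fun q => v q.2.2.1
  have a4 := avg fun q => v q.2.2.2
  have a12 := avg fun q => κ q.1 q.2.1
  have a13 := avg fun q => κ q.1 q.2.2.1
  have a14 := avg fun q => κ q.1 q.2.2.2
  have a23 := avg fun q => κ q.2.1 q.2.2.1
  have a24 := avg fun q => κ q.2.1 q.2.2.2
  have a34 := avg fun q => κ q.2.2.1 q.2.2.2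
  rw [s2] at a2
  rw [s3] at a3
  rw [s4] at a4
  rw [s13] at a13
  rw [s14] at a14
  rw [s23] at a23
  rw [s24] at a24
  rw [s34] at a34
  simp only [exponentSq, mul_add, replicaAvg_add] at *
  linarith

end CavitySystem
end SecondOrderExpansion

section GaussianVectors

/-- The law of a standard Gaussian vector indexed by `ι`. -/
abbrev stdGaussianPi (ι : Type*) [Fintype ι] : Measure (ι → ℝ) :=
  Measure.pi fun _ => gaussianReal 0 1

lemma integrable_exp_linear {ι : Type*} [Fintype ι] (a : ι → ℝ) :
    Integrable (fun x : ι → ℝ => exp (∑ i, a i * x i)) (stdGaussianPi ι) := by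
  simp only [exp_sum]
  exact Integrable.fintype_prod (f := fun i y => exp (a i * y))
    fun i => integrable_exp_mul_gaussianReal _

lemma integral_exp_linear {ι : Type*} [Fintype ι] (a : ι → ℝ) :
    ∫ x : ι → ℝ, exp (∑ i, a i * x i) ∂stdGaussianPi ι = exp ((∑ i, a i ^ 2) / 2) := by
  simp only [exp_sum]
  rw [integral_fintype_prod_eq_prod (f := fun i y => exp (a i * y)), Finset.sum_div, exp_sum]
  refine Finset.prod_congr rfl fun i _ => ?_
  have := congrFun (mgf_fun_id_gaussianReal (μ := 0) (v := 1)) (a i)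
  simpa [mgf] using this

/-- A function of some coordinates is uncorrelated with the exponential of a linear form in the
other coordinates. -/
lemma integral_mul_exp_linear {ι : Type*} [Fintype ι] (S : Set ι) {F : (ι → ℝ) → ℝ}
    (hS : ∀ x y : ι → ℝ, (∀ i, i ∉ S → x i = y i) → F x = F y)
    {a : ι → ℝ} (ha : ∀ i, i ∉ S → a i = 0) :
    ∫ x, F x * exp (∑ i, a i * x i) ∂stdGaussianPi ι =
      (∫ x, F x ∂stdGaussianPi ι) * exp ((∑ i, a i ^ 2) / 2) := by
  classical
  let e := MeasurableEquiv.piEquivPiSubtypeProd (fun _ : ι => ℝ) (· ∈ S)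
  have he := measurePreserving_piEquivPiSubtypeProd (fun _ : ι => gaussianReal 0 1) (· ∈ S)
  let G : ({i // i ∉ S} → ℝ) → ℝ := fun y => F (e.symm (0, y))
  have hF : ∀ x, F x = G (e x).2 := fun x => by
    refine hS _ _ fun i hi => ?_
    simp [e, MeasurableEquiv.piEquivPiSubtypeProd, Equiv.piEquivPiSubtypeProd, hi]
  have hE : ∀ x, exp (∑ i, a i * x i) = exp (∑ i : {i // i ∈ S}, a i * (e x).1 i) := fun x => by
    congr 1
    rw [← Fintype.sum_subtype_add_sum_subtype (fun i => i ∈ S) fun i => a i * x i]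
    rw [Finset.sum_eq_zero (s := (univ : Finset {i // ¬ i ∈ S}))
      fun i _ => by rw [ha i i.2, zero_mul], add_zero]
    rfl
  have h2 : ∑ i, a i ^ 2 = ∑ i : {i // i ∈ S}, a i ^ 2 := by
    rw [← Fintype.sum_subtype_add_sum_subtype (fun i => i ∈ S) fun i => a i ^ 2]
    rw [Finset.sum_eq_zero (s := (univ : Finset {i // ¬ i ∈ S}))
      fun i _ => by rw [ha i i.2]; simp, add_zero]
  have i1 : ∫ x, F x * exp (∑ i, a i * x i) ∂stdGaussianPi ι =
      ∫ z, exp (∑ i : {i // i ∈ S}, a i * z.1 i) * G z.2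
        ∂((stdGaussianPi {i // i ∈ S}).prod (stdGaussianPi {i // i ∉ S})) := by
    rw [← he.integral_comp' (f := e)]
    exact integral_congr_ae (.of_forall fun x => by
      show F x * exp (∑ i, a i * x i) = _
      rw [hE x, hF x, mul_comm])
  have i2 : ∫ x, F x ∂stdGaussianPi ι =
      ∫ z, (fun _ => (1 : ℝ)) z.1 * G z.2
        ∂((stdGaussianPi {i // i ∈ S}).prod (stdGaussianPi {i // i ∉ S})) := by
    rw [← he.integral_comp' (f := e)]
    exact integral_congr_ae (.of_forall fun x => by
      show F x = _
      rw [hF x]; simp only [one_mul])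
  rw [i1, i2, integral_prod_mul (fun z : {i // i ∈ S} → ℝ => exp (∑ i : {i // i ∈ S}, a i * z i)) G,
    integral_prod_mul (fun _ : {i // i ∈ S} → ℝ => (1 : ℝ)) G, integral_exp_linear, h2]
  simp [mul_comm]

/-- Three independent standard Gaussian vectors as a single one. -/
lemma measurePreserving_triple (ι : Type*) [Fintype ι] :
    MeasurePreserving
      (fun x : ι ⊕ ι ⊕ ι → ℝ =>
        ((fun i => x (.inl i), fun i => x (.inr (.inl i)), fun i => x (.inr (.inr i))) :
          (ι → ℝ) × (ι → ℝ) × (ι → ℝ)))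
      (stdGaussianPi (ι ⊕ ι ⊕ ι))
      ((stdGaussianPi ι).prod ((stdGaussianPi ι).prod (stdGaussianPi ι))) := by
  have h1 := measurePreserving_sumPiEquivProdPi (ι := ι) (ι' := ι ⊕ ι) (X := fun _ => ℝ)
    (fun _ => gaussianReal 0 1)
  have h2 := measurePreserving_sumPiEquivProdPi (ι := ι) (ι' := ι) (X := fun _ => ℝ)
    (fun _ => gaussianReal 0 1)
  exact ((MeasurePreserving.id _).prod h2).comp h1

lemma integrable_triple_exp_linear {ι : Type*} [Fintype ι]
    {F : (ι → ℝ) × (ι → ℝ) × (ι → ℝ) → ℝ} (hF : Measurable F) (hb : ∀ ω, |F ω| ≤ 1)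
    (a b c : ι → ℝ) :
    Integrable (fun ω => F ω * exp ((∑ i, a i * ω.1 i) + (∑ i, b i * ω.2.1 i) +
        ∑ i, c i * ω.2.2 i))
      ((stdGaussianPi ι).prod ((stdGaussianPi ι).prod (stdGaussianPi ι))) := by
  have h := (integrable_exp_linear a).mul_prod
    ((integrable_exp_linear b).mul_prod (integrable_exp_linear c))
  refine (h.bdd_mul (f := F) (c := 1) hF.aestronglyMeasurable (.of_forall hb)).congr
    (.of_forall fun ω => ?_)
  simp only [exp_add, mul_assoc]

lemma integral_triple_mul_exp_linear {ι : Type*} [Fintype ι] (S : Set ι)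
    {F : (ι → ℝ) × (ι → ℝ) × (ι → ℝ) → ℝ} (hF : Measurable F)
    (hS : ∀ x y : (ι → ℝ) × (ι → ℝ) × (ι → ℝ),
      (∀ i, i ∉ S → x.1 i = y.1 i ∧ x.2.1 i = y.2.1 i ∧ x.2.2 i = y.2.2 i) → F x = F y)
    {a b c : ι → ℝ} (ha : ∀ i, i ∉ S → a i = 0) (hb : ∀ i, i ∉ S → b i = 0)
    (hc : ∀ i, i ∉ S → c i = 0) :
    ∫ ω, F ω * exp ((∑ i, a i * ω.1 i) + (∑ i, b i * ω.2.1 i) + ∑ i, c i * ω.2.2 i)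
        ∂((stdGaussianPi ι).prod ((stdGaussianPi ι).prod (stdGaussianPi ι))) =
      (∫ ω, F ω ∂((stdGaussianPi ι).prod ((stdGaussianPi ι).prod (stdGaussianPi ι)))) *
        exp ((∑ i, (a i ^ 2 + b i ^ 2 + c i ^ 2)) / 2) := by
  have hm := measurePreserving_triple ι
  have tr : ∀ G : (ι → ℝ) × (ι → ℝ) × (ι → ℝ) → ℝ, Measurable G →
      ∫ ω, G ω ∂((stdGaussianPi ι).prod ((stdGaussianPi ι).prod (stdGaussianPi ι))) =
      ∫ x, G ((fun i => x (.inl i), fun i => x (.inr (.inl i)), fun i => x (.inr (.inr i))))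
        ∂(stdGaussianPi (ι ⊕ ι ⊕ ι)) := fun G hG => by
    rw [← hm.map_eq, integral_map hm.measurable.aemeasurable hG.aestronglyMeasurable]
  rw [tr _ hF, tr _ (by fun_prop)]
  have := integral_mul_exp_linear (ι := ι ⊕ ι ⊕ ι)
    {k | Sum.elim (· ∈ S) (Sum.elim (· ∈ S) (· ∈ S)) k}
    (F := fun x => F ((fun i => x (.inl i), fun i => x (.inr (.inl i)),
      fun i => x (.inr (.inr i))))) ?_ (a := Sum.elim a (Sum.elim b c)) ?_
  · simp only [Fintype.sum_sum_type, Sum.elim_inl, Sum.elim_inr] at this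
    simp only [Finset.sum_add_distrib, add_assoc]
    exact this
  · intro x y hxy
    exact hS _ _ fun i hi => ⟨hxy _ hi, hxy _ hi, hxy _ hi⟩
  · rintro (i | i | i) hi
    · exact ha i hi
    · exact hb i hi
    · exact hc i hi

/-- A normalised combination of two independent standard Gaussian vectors is standard. -/
lemma measurePreserving_rotation (ι : Type*) [Fintype ι] {a b : ℝ} (hab : a ^ 2 + b ^ 2 = 1) :
    MeasurePreserving (fun x : (ι → ℝ) × (ι → ℝ) => fun i => a * x.1 i + b * x.2 i)
      ((stdGaussianPi ι).prod (stdGaussianPi ι)) (stdGaussianPi ι) := by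
  have h1 : MeasurePreserving (fun x : ℝ × ℝ => a * x.1 + b * x.2)
      ((gaussianReal 0 1).prod (gaussianReal 0 1)) (gaussianReal 0 1) := by
    refine ⟨by fun_prop, ?_⟩
    have hi : IndepFun (fun x : ℝ × ℝ => a * x.1) (fun x : ℝ × ℝ => b * x.2)
        ((gaussianReal 0 1).prod (gaussianReal 0 1)) :=
      indepFun_prod (X := fun x => a * x) (Y := fun x => b * x) (by fun_prop) (by fun_prop)
    have hX : ((gaussianReal 0 1).prod (gaussianReal 0 1)).map (fun x : ℝ × ℝ => a * x.1) =
        gaussianReal (a * 0) (NNReal.mk (a ^ 2) (sq_nonneg a) * 1) := by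
      rw [← gaussianReal_map_const_mul]
      conv_rhs => rw [← (measurePreserving_fst (μ := gaussianReal 0 1)
        (ν := gaussianReal 0 1)).map_eq]
      rw [Measure.map_map (by fun_prop) measurable_fst]
      rfl
    have hY : ((gaussianReal 0 1).prod (gaussianReal 0 1)).map (fun x : ℝ × ℝ => b * x.2) =
        gaussianReal (b * 0) (NNReal.mk (b ^ 2) (sq_nonneg b) * 1) := by
      rw [← gaussianReal_map_const_mul]
      conv_rhs => rw [← (measurePreserving_snd (μ := gaussianReal 0 1)
        (ν := gaussianReal 0 1)).map_eq]
      rw [Measure.map_map (by fun_prop) measurable_snd]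
      rfl
    have := gaussianReal_add_gaussianReal_of_indepFun hi hX hY
    have hv : NNReal.mk (a ^ 2) (sq_nonneg a) * 1 + NNReal.mk (b ^ 2) (sq_nonneg b) * 1 = 1 := by
      ext
      simpa using hab
    rw [hv, mul_zero, mul_zero, add_zero] at this
    exact this
  have h2 := (measurePreserving_arrowProdEquivProdArrow ℝ ℝ ι (fun _ => gaussianReal 0 1)
    (fun _ => gaussianReal 0 1)).symm
  exact (measurePreserving_pi (fun _ : ι => (gaussianReal 0 1).prod (gaussianReal 0 1))
    (fun _ => gaussianReal 0 1) fun _ => h1).comp h2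

end GaussianVectors

section Spins

variable {N : ℕ}

lemma spin_mul_self (b : Bool) : spin b * spin b = 1 := by
  cases b <;> simp [spin]

lemma abs_spin (b : Bool) : |spin b| = 1 := by
  cases b <;> simp [spin]

lemma spin_not (b : Bool) : spin (!b) = -spin b := by
  cases b <;> simp [spin]

lemma spinLast_eq (hN : 0 < N) (σ : Config N) :
    spinLast σ = spin (σ ⟨N - 1, Nat.sub_lt hN Nat.one_pos⟩) := by
  simp [spinLast, hN]

lemma spinLast_mul_self (hN : 0 < N) (σ : Config N) : spinLast σ * spinLast σ = 1 := by
  rw [spinLast_eq hN, spin_mul_self]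

lemma abs_spinLast (hN : 0 < N) (σ : Config N) : |spinLast σ| = 1 := by
  rw [spinLast_eq hN, abs_spin]

lemma ovlp_comm (σ τ : Config N) : ovlp N σ τ = ovlp N τ σ := by
  simp only [ovlp, mul_comm]

lemma ovlpm_comm (σ τ : Config N) : ovlpm N σ τ = ovlpm N τ σ := by
  simp only [ovlpm, mul_comm]

lemma card_filter_lt_pred (hN : 0 < N) :
    (#(univ.filter fun i : Fin N => (i : ℕ) < N - 1) : ℝ) = N - 1 := by
  rw [Fin.card_filter_val_lt, min_eq_right (Nat.sub_le _ _), Nat.cast_pred hN]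

lemma ovlpm_self (hN : 0 < N) (σ : Config N) : ovlpm N σ σ = (N - 1) / N := by
  simp only [ovlpm, spin_mul_self, Finset.sum_const, nsmul_eq_mul, mul_one,
    card_filter_lt_pred hN]

lemma abs_ovlpm_le (hN : 0 < N) (σ τ : Config N) : |ovlpm N σ τ| ≤ 1 := by
  have h0 : (0 : ℝ) < N := by exact_mod_cast hN
  rw [ovlpm, abs_div, abs_of_pos h0, div_le_one h0]
  refine (Finset.abs_sum_le_sum_abs _ _).trans ?_
  simp only [abs_mul, abs_spin, Finset.sum_const, nsmul_eq_mul, mul_one, card_filter_lt_pred hN]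
  linarith

lemma abs_ovlp_le (hN : 0 < N) (σ τ : Config N) : |ovlp N σ τ| ≤ 1 := by
  have h0 : (0 : ℝ) < N := by exact_mod_cast hN
  rw [ovlp, abs_div, abs_of_pos h0, div_le_one h0]
  refine (Finset.abs_sum_le_sum_abs _ _).trans ?_
  simp [abs_mul, abs_spin]

lemma filter_not_lt_pred (hN : 0 < N) :
    (univ.filter fun i : Fin N => ¬ (i : ℕ) < N - 1) = {⟨N - 1, Nat.sub_lt hN Nat.one_pos⟩} := by
  ext i
  simp only [mem_filter, mem_univ, true_and, mem_singleton, Fin.ext_iff]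
  omega

lemma ovlp_eq (hN : 0 < N) (σ τ : Config N) :
    ovlp N σ τ = ovlpm N σ τ + spinLast σ * spinLast τ / N := by
  rw [ovlp, ovlpm, ← Finset.sum_filter_add_sum_filter_not univ fun i : Fin N => (i : ℕ) < N - 1,
    filter_not_lt_pred hN, Finset.sum_singleton, add_div, spinLast_eq hN, spinLast_eq hN]

/-- Reverse the last spin. -/
def flipLast (σ : Config N) : Config N := fun i => if (i : ℕ) = N - 1 then !σ i else σ i

lemma flipLast_involutive : Function.Involutive (flipLast (N := N)) := fun σ => by
  funext i
  by_cases hi : (i : ℕ) = N - 1 <;> simp [flipLast, hi]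

lemma flipLast_apply_of_lt (σ : Config N) {i : Fin N} (hi : (i : ℕ) < N - 1) :
    flipLast σ i = σ i := by
  simp [flipLast, hi.ne]

lemma spinLast_flipLast (hN : 0 < N) (σ : Config N) : spinLast (flipLast σ) = -spinLast σ := by
  rw [spinLast_eq hN, spinLast_eq hN, ← spin_not]
  simp [flipLast]

lemma ovlpm_flipLast (σ τ : Config N) : ovlpm N (flipLast σ) τ = ovlpm N σ τ := by
  unfold ovlpm
  congr 1
  refine Finset.sum_congr rfl fun i hi => ?_
  rw [flipLast_apply_of_lt σ (Finset.mem_filter.1 hi).2]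

lemma ovlpm_flipLast_right (σ τ : Config N) : ovlpm N σ (flipLast τ) = ovlpm N σ τ := by
  rw [ovlpm_comm, ovlpm_flipLast, ovlpm_comm]

lemma hamCav_flipLast (β : ℝ) (g : Fin N × Fin N → ℝ) (σ : Config N) :
    hamCav N β g (flipLast σ) = hamCav N β g σ := by
  unfold hamCav
  congr 1
  refine Finset.sum_congr rfl fun p hp => ?_
  obtain ⟨h1, h2⟩ := (Finset.mem_filter.1 hp).2
  rw [flipLast_apply_of_lt σ h2, flipLast_apply_of_lt σ (lt_trans h1 h2)]

/-- Reverse the last spin in the first component of a pair. -/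
def flipLeft (N : ℕ) : Config N × Config N ≃ Config N × Config N :=
  (Function.Involutive.toPerm _ flipLast_involutive).prodCongr (Equiv.refl _)

/-- Reverse the last spin in both components of a pair. -/
def flipBoth (N : ℕ) : Config N × Config N ≃ Config N × Config N :=
  (Function.Involutive.toPerm _ flipLast_involutive).prodCongr
    (Function.Involutive.toPerm _ flipLast_involutive)

@[simp]
lemma flipLeft_apply (ρ : Config N × Config N) : flipLeft N ρ = (flipLast ρ.1, ρ.2) := rfl

@[simp]
lemma flipBoth_apply (ρ : Config N × Config N) : flipBoth N ρ = (flipLast ρ.1, flipLast ρ.2) :=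
  rfl

end Spins

section CavityField

variable {N : ℕ} {β t : ℝ}

/-- The coefficients of the cavity field of a configuration as a linear form in the disorder. -/
def cavCoef (β : ℝ) (σ : Config N) (p : Fin N × Fin N) : ℝ :=
  if (p.1 : ℕ) < N - 1 ∧ (p.2 : ℕ) = N - 1 then β / √N * spinLast σ * spin (σ p.1) else 0

lemma sum_ite_last (hN : 0 < N) (F : Fin N × Fin N → ℝ) :
    ∑ p : Fin N × Fin N, (if (p.1 : ℕ) < N - 1 ∧ (p.2 : ℕ) = N - 1 then F p else 0) =
      ∑ i ∈ univ.filter (fun i : Fin N => (i : ℕ) < N - 1),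
        F (i, ⟨N - 1, Nat.sub_lt hN Nat.one_pos⟩) := by
  rw [Fintype.sum_prod_type, Finset.sum_filter]
  refine Finset.sum_congr rfl fun i _ => ?_
  rw [Finset.sum_eq_single ⟨N - 1, Nat.sub_lt hN Nat.one_pos⟩]
  · simp
  · intro j _ hj
    exact if_neg fun h => hj (Fin.ext h.2)
  · simp

lemma cavField_eq (hN : 0 < N) (g g' : Fin N × Fin N → ℝ) (σ : Config N) :
    cavField N β t g g' σ =
      √t * ∑ p, cavCoef β σ p * g p + √(1 - t) * ∑ p, cavCoef β σ p * g' p := by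
  simp only [cavCoef, ite_mul, zero_mul]
  rw [sum_ite_last hN, sum_ite_last hN, cavField, dif_pos hN, spinLast_eq hN]
  simp only [Finset.mul_sum, ← Finset.sum_add_distrib]
  exact Finset.sum_congr rfl fun i _ => by ring

lemma sum_cavCoef_mul (hN : 0 < N) (σ τ : Config N) :
    ∑ p, cavCoef β σ p * cavCoef β τ p = β ^ 2 * (spinLast σ * spinLast τ * ovlpm N σ τ) := by
  have h0 : (0 : ℝ) < N := by exact_mod_cast hN
  have hs : √(N : ℝ) ^ 2 = N := Real.sq_sqrt h0.le
  have : ∀ p : Fin N × Fin N, cavCoef β σ p * cavCoef β τ p =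
      if (p.1 : ℕ) < N - 1 ∧ (p.2 : ℕ) = N - 1 then
        β ^ 2 / N * (spinLast σ * spinLast τ) * (spin (σ p.1) * spin (τ p.1)) else 0 := fun p => by
    unfold cavCoef
    split_ifs
    · rw [show β ^ 2 / (N : ℝ) = (β / √N) ^ 2 by rw [div_pow, hs]]; ring
    · simp
  simp only [this]
  rw [sum_ite_last hN, ← Finset.mul_sum, ovlpm]
  field_simp

lemma cavCoef_eq_zero (σ : Config N) {p : Fin N × Fin N} (hp : ¬ (p.2 : ℕ) = N - 1) :
    cavCoef β σ p = 0 :=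
  if_neg fun h => hp h.2

/-- The disorder space. -/
abbrev Disorder (N : ℕ) :=
  (Fin N × Fin N → ℝ) × (Fin N × Fin N → ℝ) × (Fin N × Fin N → ℝ)

/-- The cavity Gibbs probabilities at `s = 0`. -/
def cavProb (N : ℕ) (β t : ℝ) (ρ : Config N × Config N) (ω : Disorder N) : ℝ :=
  wTS N β t 0 ω.1 ω.2.1 ω.2.2 ρ / ∑ ρ', wTS N β t 0 ω.1 ω.2.1 ω.2.2 ρ'

/-- The cavity field acting on a pair. -/
def pairField (N : ℕ) (β t : ℝ) (ρ : Config N × Config N) (ω : Disorder N) : ℝ :=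
  cavField N β t ω.1 ω.2.1 ρ.1 + cavField N β t ω.1 ω.2.2 ρ.2

/-- Half the non-constant part of the variance of the cavity field acting on a pair. -/
def pairVar (N : ℕ) (β t : ℝ) (ρ : Config N × Config N) : ℝ :=
  β ^ 2 * t * (spinLast ρ.1 * spinLast ρ.2 * ovlpm N ρ.1 ρ.2)

lemma hamTS_zero (g g' : Fin N × Fin N → ℝ) (σ : Config N) :
    hamTS N β t 0 g g' σ = √t * hamCav N β g σ + √(1 - t) * hamCav N β g' σ := by
  simp [hamTS]

lemma hamTS_flipLast_zero (g g' : Fin N × Fin N → ℝ) (σ : Config N) :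
    hamTS N β t 0 g g' (flipLast σ) = hamTS N β t 0 g g' σ := by
  simp only [hamTS_zero, hamCav_flipLast]

lemma cavField_flipLast (hN : 0 < N) (g g' : Fin N × Fin N → ℝ) (σ : Config N) :
    cavField N β t g g' (flipLast σ) = -cavField N β t g g' σ := by
  have : ∀ p, cavCoef β (flipLast σ) p = -cavCoef β σ p := fun p => by
    unfold cavCoef
    split_ifs with h
    · rw [spinLast_flipLast hN, flipLast_apply_of_lt σ h.1]; ring
    · simp
  simp only [cavField_eq hN, this, neg_mul, Finset.sum_neg_distrib]
  ring

lemma wTS_pos (s : ℝ) (g g' g'' : Fin N × Fin N → ℝ) (ρ : Config N × Config N) :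
    0 < wTS N β t s g g' g'' ρ := exp_pos _

lemma sum_wTS_pos (s : ℝ) (g g' g'' : Fin N × Fin N → ℝ) :
    0 < ∑ ρ, wTS N β t s g g' g'' ρ :=
  Finset.sum_pos (fun _ _ => wTS_pos _ _ _ _ _) Finset.univ_nonempty

lemma cavProb_nonneg (ρ : Config N × Config N) (ω : Disorder N) : 0 ≤ cavProb N β t ρ ω :=
  div_nonneg (wTS_pos _ _ _ _ _).le (sum_wTS_pos _ _ _ _).le

lemma sum_cavProb (ω : Disorder N) : ∑ ρ, cavProb N β t ρ ω = 1 := by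
  simp only [cavProb, ← Finset.sum_div]
  exact div_self (sum_wTS_pos _ _ _ _).ne'

lemma cavProb_le_one (ρ : Config N × Config N) (ω : Disorder N) : cavProb N β t ρ ω ≤ 1 := by
  rw [← sum_cavProb (β := β) (t := t) ω]
  exact Finset.single_le_sum (fun ρ' _ => cavProb_nonneg ρ' ω) (Finset.mem_univ ρ)

lemma measurable_cavProb (ρ : Config N × Config N) : Measurable (cavProb N β t ρ) := by
  unfold cavProb wTS
  simp only [hamTS_zero]
  unfold hamCav
  fun_prop

lemma cavProb_congr (ρ : Config N × Config N) (ω ω' : Disorder N)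
    (h : ∀ p : Fin N × Fin N, p ∉ {p : Fin N × Fin N | (p.2 : ℕ) = N - 1} →
      ω.1 p = ω'.1 p ∧ ω.2.1 p = ω'.2.1 p ∧ ω.2.2 p = ω'.2.2 p) :
    cavProb N β t ρ ω = cavProb N β t ρ ω' := by
  have hc : ∀ (g g' : Fin N × Fin N → ℝ),
      (∀ p : Fin N × Fin N, p ∉ {p : Fin N × Fin N | (p.2 : ℕ) = N - 1} → g p = g' p) →
      hamCav N β g = hamCav N β g' := fun g g' hg => by
    funext σ
    unfold hamCav
    congr 1
    refine Finset.sum_congr rfl fun p hp => ?_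
    rw [hg p (Finset.mem_filter.1 hp).2.2.ne]
  unfold cavProb wTS
  simp only [hamTS_zero, hc _ _ fun p hp => (h p hp).1, hc _ _ fun p hp => (h p hp).2.1,
    hc _ _ fun p hp => (h p hp).2.2]

lemma pairField_eq (hN : 0 < N) (ρ : Config N × Config N) (ω : Disorder N) :
    pairField N β t ρ ω =
      (∑ p, √t * (cavCoef β ρ.1 p + cavCoef β ρ.2 p) * ω.1 p) +
      (∑ p, √(1 - t) * cavCoef β ρ.1 p * ω.2.1 p) + ∑ p, √(1 - t) * cavCoef β ρ.2 p * ω.2.2 p := by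
  simp only [pairField, cavField_eq hN, Finset.mul_sum, ← Finset.sum_add_distrib]
  exact Finset.sum_congr rfl fun p _ => by ring

lemma covariance_pairField (hN : 0 < N) (ht : t ∈ Set.Icc (0 : ℝ) 1) (ρ ρ' : Config N × Config N) :
    ∑ p, (√t * (cavCoef β ρ.1 p + cavCoef β ρ.2 p) * (√t * (cavCoef β ρ'.1 p + cavCoef β ρ'.2 p)) +
      √(1 - t) * cavCoef β ρ.1 p * (√(1 - t) * cavCoef β ρ'.1 p) +
      √(1 - t) * cavCoef β ρ.2 p * (√(1 - t) * cavCoef β ρ'.2 p)) = 2 * Ufun N β t ρ ρ' := by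
  have h1 : √t ^ 2 = t := Real.sq_sqrt ht.1
  have h2 : √(1 - t) ^ 2 = 1 - t := Real.sq_sqrt (by linarith [ht.2])
  have : ∀ p, (√t * (cavCoef β ρ.1 p + cavCoef β ρ.2 p) *
        (√t * (cavCoef β ρ'.1 p + cavCoef β ρ'.2 p)) +
      √(1 - t) * cavCoef β ρ.1 p * (√(1 - t) * cavCoef β ρ'.1 p) +
      √(1 - t) * cavCoef β ρ.2 p * (√(1 - t) * cavCoef β ρ'.2 p)) =
      cavCoef β ρ.1 p * cavCoef β ρ'.1 p + cavCoef β ρ.2 p * cavCoef β ρ'.2 p +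
      t * (cavCoef β ρ.1 p * cavCoef β ρ'.2 p + cavCoef β ρ.2 p * cavCoef β ρ'.1 p) := fun p => by
    linear_combination (cavCoef β ρ.1 p + cavCoef β ρ.2 p) * (cavCoef β ρ'.1 p + cavCoef β ρ'.2 p)
      * h1 + (cavCoef β ρ.1 p * cavCoef β ρ'.1 p + cavCoef β ρ.2 p * cavCoef β ρ'.2 p) * h2
  simp only [this, Finset.sum_add_distrib, ← Finset.mul_sum, sum_cavCoef_mul hN]
  unfold Ufun
  ring

lemma measurable_pairField (hN : 0 < N) (ρ : Config N × Config N) :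
    Measurable (pairField N β t ρ) := by
  have : pairField N β t ρ = _ := funext (pairField_eq hN ρ)
  rw [this]
  fun_prop

lemma abs_spinLast_mul_ovlpm_le (hN : 0 < N) (σ τ : Config N) :
    |spinLast σ * spinLast τ * ovlpm N σ τ| ≤ 1 := by
  rw [abs_mul, abs_mul, abs_spinLast hN, abs_spinLast hN, one_mul, one_mul]
  exact abs_ovlpm_le hN σ τ

/-- A combination of four cavity fields as a linear function of the disorder. -/
lemma four_pairField_eq (hN : 0 < N) (x y z u : Config N × Config N) (a b c d : ℝ)
    (ω : Disorder N) :
    a * pairField N β t x ω + b * pairField N β t y ω + c * pairField N β t z ω +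
        d * pairField N β t u ω =
      (∑ p, (a * (√t * (cavCoef β x.1 p + cavCoef β x.2 p)) +
        b * (√t * (cavCoef β y.1 p + cavCoef β y.2 p)) +
        c * (√t * (cavCoef β z.1 p + cavCoef β z.2 p)) +
        d * (√t * (cavCoef β u.1 p + cavCoef β u.2 p))) * ω.1 p) +
      (∑ p, (a * (√(1 - t) * cavCoef β x.1 p) + b * (√(1 - t) * cavCoef β y.1 p) +
        c * (√(1 - t) * cavCoef β z.1 p) + d * (√(1 - t) * cavCoef β u.1 p)) * ω.2.1 p) +
      ∑ p, (a * (√(1 - t) * cavCoef β x.2 p) + b * (√(1 - t) * cavCoef β y.2 p) +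
        c * (√(1 - t) * cavCoef β z.2 p) + d * (√(1 - t) * cavCoef β u.2 p)) * ω.2.2 p := by
  simp only [pairField_eq hN, Finset.mul_sum, ← Finset.sum_add_distrib]
  exact Finset.sum_congr rfl fun p _ => by ring

lemma prod_cavProb_le (x y z u : Config N × Config N) (ω : Disorder N) :
    |cavProb N β t x ω * cavProb N β t y ω * cavProb N β t z ω * cavProb N β t u ω| ≤ 1 := by
  simp only [abs_mul, abs_of_nonneg (cavProb_nonneg _ ω)]
  have h := fun ρ => cavProb_nonneg (β := β) (t := t) ρ ω
  have h1 := fun ρ => cavProb_le_one (β := β) (t := t) ρ ω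
  exact mul_le_one₀ (mul_le_one₀ (mul_le_one₀ (h1 _) (h _) (h1 _)) (h _) (h1 _)) (h _) (h1 _)

lemma measurable_prod_cavProb (x y z u : Config N × Config N) :
    Measurable fun ω => cavProb N β t x ω * cavProb N β t y ω * cavProb N β t z ω *
      cavProb N β t u ω :=
  (((measurable_cavProb x).mul (measurable_cavProb y)).mul (measurable_cavProb z)).mul
    (measurable_cavProb u)

lemma integral_cavProb_mul_exp (hN : 0 < N) (ht : t ∈ Set.Icc (0 : ℝ) 1)
    (x y z u : Config N × Config N) (a b c d : ℝ) :
    ∫ ω, cavProb N β t x ω * cavProb N β t y ω * cavProb N β t z ω * cavProb N β t u ω *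
      exp (a * pairField N β t x ω + b * pairField N β t y ω + c * pairField N β t z ω +
        d * pairField N β t u ω) ∂disM3 N =
    replicaWeight (disM3 N) (cavProb N β t) (x, y, z, u) *
      exp ((a * a * (2 * Ufun N β t x x) + b * b * (2 * Ufun N β t y y) +
        c * c * (2 * Ufun N β t z z) + d * d * (2 * Ufun N β t u u)) / 2 +
        a * b * (2 * Ufun N β t x y) + a * c * (2 * Ufun N β t x z) +
        a * d * (2 * Ufun N β t x u) + b * c * (2 * Ufun N β t y z) +
        b * d * (2 * Ufun N β t y u) + c * d * (2 * Ufun N β t z u)) := by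
  simp only [four_pairField_eq hN]
  refine (integral_triple_mul_exp_linear {p : Fin N × Fin N | (p.2 : ℕ) = N - 1}
    (measurable_prod_cavProb x y z u) ?_ ?_ ?_ ?_).trans ?_
  · intro ω ω' h
    simp only [cavProb_congr _ ω ω' h]
  · intro p hp
    simp [cavCoef_eq_zero _ hp]
  · intro p hp
    simp [cavCoef_eq_zero _ hp]
  · intro p hp
    simp [cavCoef_eq_zero _ hp]
  · congr 2
    simp only [← covariance_pairField hN ht, Finset.mul_sum, Finset.sum_div,
      ← Finset.sum_add_distrib]
    exact Finset.sum_congr rfl fun p _ => by ring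

lemma cavitySystem (hN : 0 < N) (hβ : β ∈ Set.Ioc (0 : ℝ) 1) (ht : t ∈ Set.Icc (0 : ℝ) 1) :
    CavitySystem (disM3 N) (cavProb N β t) (pairField N β t) (fun ρ ρ' => 2 * Ufun N β t ρ ρ')
      (pairVar N β t) (β ^ 2 * ((N - 1) / N)) (flipBoth N) (flipLeft N) := by
  have h0 : (1 : ℝ) ≤ N := by exact_mod_cast hN
  have hβ2 : β ^ 2 ≤ 1 := pow_le_one₀ hβ.1.le hβ.2
  have hβt : β ^ 2 * t ≤ 1 := mul_le_one₀ hβ2 ht.1 ht.2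
  have hβ0 : 0 ≤ β ^ 2 := sq_nonneg β
  have hβt0 : 0 ≤ β ^ 2 * t := mul_nonneg hβ0 ht.1
  have hfr : 0 ≤ ((N : ℝ) - 1) / N ∧ ((N : ℝ) - 1) / N ≤ 1 :=
    ⟨by apply div_nonneg <;> linarith, by rw [div_le_one] <;> linarith⟩
  have key : ∀ σ τ : Config N, |spinLast σ * spinLast τ * ovlpm N σ τ| ≤ 1 :=
    abs_spinLast_mul_ovlpm_le hN
  refine
    { nonneg := cavProb_nonneg
      sum_one := sum_cavProb
      measurable_p := measurable_cavProb
      measurable_h := measurable_pairField hN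
      integrable := fun x y z u a b c d => ?_
      integral_eq := integral_cavProb_mul_exp hN ht
      self := fun ρ => ?_
      L_le := mul_le_one₀ hβ2 hfr.1 hfr.2
      v_le := fun ρ => ?_
      κ_le := fun ρ ρ' => ?_
      κ_comm := fun ρ ρ' => ?_
      p_Θ := fun ρ ω => ?_
      p_θ := fun ρ ω => ?_
      h_Θ := fun ρ ω => ?_
      κ_Θ := fun ρ ρ' => ?_
      v_θ := fun ρ => ?_ }
  · simp only [four_pairField_eq hN]
    exact integrable_triple_exp_linear (measurable_prod_cavProb x y z u) (prod_cavProb_le x y z u)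
      _ _ _
  · unfold Ufun pairVar
    rw [ovlpm_self hN, ovlpm_self hN, spinLast_mul_self hN, spinLast_mul_self hN,
      ovlpm_comm ρ.2 ρ.1]
    ring
  · unfold pairVar
    rw [abs_mul, abs_of_nonneg hβt0]
    exact mul_le_one₀ hβt (abs_nonneg _) (key _ _)
  · have h1 := abs_le.1 (key ρ.1 ρ'.1)
    have h2 := abs_le.1 (key ρ.2 ρ'.2)
    have h3 := abs_le.1 (key ρ.1 ρ'.2)
    have h4 := abs_le.1 (key ρ.2 ρ'.1)
    unfold Ufun
    rw [abs_le]
    constructor <;> nlinarith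
  · unfold Ufun
    rw [ovlpm_comm ρ'.1, ovlpm_comm ρ'.2, ovlpm_comm ρ'.1, ovlpm_comm ρ'.2]
    ring
  · simp only [cavProb, wTS, flipBoth_apply, hamTS_flipLast_zero]
  · simp only [cavProb, wTS, flipLeft_apply, hamTS_flipLast_zero]
  · simp only [pairField, flipBoth_apply, cavField_flipLast hN]
    ring
  · simp only [Ufun, flipBoth_apply, spinLast_flipLast hN, ovlpm_flipLast_right]
    ring
  · simp only [pairVar, flipLeft_apply, spinLast_flipLast hN, ovlpm_flipLast]
    ring

lemma wTS_one (g g' g'' : Fin N × Fin N → ℝ) (ρ : Config N × Config N) :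
    wTS N β t 1 g g' g'' ρ =
      wTS N β t 0 g g' g'' ρ * exp (pairField N β t ρ (g, g', g'')) := by
  unfold wTS pairField
  rw [← exp_add]
  simp only [hamTS, Real.sqrt_one, Real.sqrt_zero]
  congr 1
  ring

lemma EgibbsTS2_one (f : Config N × Config N → Config N × Config N → ℝ) :
    EgibbsTS2 N β t 1 f = tiltedAvg (disM3 N) (cavProb N β t) (pairField N β t) f := by
  unfold EgibbsTS2 tiltedAvg gibbsTS2
  congr 1
  ext ω
  have hZ := (sum_wTS_pos (N := N) (β := β) (t := t) 0 ω.1 ω.2.1 ω.2.2).ne'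
  set Z := ∑ ρ, wTS N β t 0 ω.1 ω.2.1 ω.2.2 ρ with hZd
  have h1 : ∀ ρ, wTS N β t 1 ω.1 ω.2.1 ω.2.2 ρ =
      Z * (cavProb N β t ρ ω * exp (pairField N β t ρ ω)) := fun ρ => by
    rw [wTS_one, cavProb, ← hZd]
    field_simp
  have h2 : ∀ ρ₁ ρ₂, f ρ₁ ρ₂ * (Z * (cavProb N β t ρ₁ ω * exp (pairField N β t ρ₁ ω))) *
      (Z * (cavProb N β t ρ₂ ω * exp (pairField N β t ρ₂ ω))) =
      Z ^ 2 * (f ρ₁ ρ₂ * (cavProb N β t ρ₁ ω * exp (pairField N β t ρ₁ ω)) *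
      (cavProb N β t ρ₂ ω * exp (pairField N β t ρ₂ ω))) := fun _ _ => by ring
  simp only [h1, h2, ← Finset.mul_sum, mul_pow]
  rw [mul_div_mul_left _ _ (pow_ne_zero 2 hZ)]

lemma integrable_prod_cavProb (x y z u : Config N × Config N) :
    Integrable (fun ω => cavProb N β t x ω * cavProb N β t y ω * cavProb N β t z ω *
      cavProb N β t u ω) (disM3 N) := by
  have : IsFiniteMeasure (disM3 N) := by unfold disM3; infer_instance
  exact Integrable.of_bound (measurable_prod_cavProb x y z u).aestronglyMeasurable 1
    (.of_forall (prod_cavProb_le x y z u))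

lemma EgibbsTS2_zero (f : Config N × Config N → Config N × Config N → ℝ) :
    EgibbsTS2 N β t 0 f =
      replicaAvg (disM3 N) (cavProb N β t) (fun q => f q.1 q.2.1) := by
  unfold EgibbsTS2 replicaAvg replicaWeight gibbsTS2
  simp only [← integral_mul_const]
  rw [← integral_finsetSum _ fun q _ =>
    (integrable_prod_cavProb q.1 q.2.1 q.2.2.1 q.2.2.2).mul_const _]
  congr 1
  ext ω
  have h := sum_four_replicas (fun ρ => cavProb N β t ρ ω) (fun _ => 0) f 0 0 0 0
  simp only [mul_zero, add_zero, exp_zero, mul_one, sum_cavProb] at h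
  simp only [mul_comm _ (f _ _)]
  rw [h]
  simp only [cavProb]
  have h2 : ∀ (ρ₁ ρ₂ : Config N × Config N) (a b Z : ℝ),
      f ρ₁ ρ₂ * (a / Z) * (b / Z) = f ρ₁ ρ₂ * a * b / Z ^ 2 := fun _ _ _ _ _ => by
    rw [sq, ← div_div]; ring
  simp only [h2, ← Finset.sum_div]

end CavityField

section Coupled

variable {N : ℕ} {β t : ℝ}

/-- The Gibbs probabilities of the SK model. -/
def gibbsProb (N : ℕ) (β : ℝ) (g : Fin N × Fin N → ℝ) (σ : Config N) : ℝ :=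
  exp (ham N β g σ) / partFun N β g

/-- The interpolated disorder. -/
def mixDisorder (t : ℝ) (g g' : Fin N × Fin N → ℝ) : Fin N × Fin N → ℝ :=
  fun p => √t * g p + √(1 - t) * g' p

lemma partFun_pos (g : Fin N × Fin N → ℝ) : 0 < partFun N β g :=
  Finset.sum_pos (fun _ _ => exp_pos _) Finset.univ_nonempty

lemma gibbsProb_nonneg (g : Fin N × Fin N → ℝ) (σ : Config N) : 0 ≤ gibbsProb N β g σ :=
  div_nonneg (exp_pos _).le (partFun_pos g).le

lemma sum_gibbsProb (g : Fin N × Fin N → ℝ) : ∑ σ, gibbsProb N β g σ = 1 := by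
  simp only [gibbsProb, ← Finset.sum_div]
  exact div_self (partFun_pos g).ne'

lemma gibbsProb_le_one (g : Fin N × Fin N → ℝ) (σ : Config N) : gibbsProb N β g σ ≤ 1 := by
  rw [← sum_gibbsProb (β := β) g]
  exact Finset.single_le_sum (fun τ _ => gibbsProb_nonneg g τ) (Finset.mem_univ σ)

@[fun_prop]
lemma measurable_gibbsProb (σ : Config N) : Measurable fun g => gibbsProb N β g σ := by
  unfold gibbsProb partFun ham
  fun_prop

lemma ham_eq (hN : 0 < N) (g : Fin N × Fin N → ℝ) (σ : Config N) :
    ham N β g σ = hamCav N β g σ + ∑ p, cavCoef β σ p * g p := by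
  have h1 : ∑ p, cavCoef β σ p * g p = β / √N *
      ∑ p ∈ univ.filter (fun p : Fin N × Fin N => p.1 < p.2 ∧ ¬ (p.2 : ℕ) < N - 1),
        g p * spin (σ p.1) * spin (σ p.2) := by
    rw [Finset.sum_filter, Finset.mul_sum]
    refine Finset.sum_congr rfl fun p _ => ?_
    have hiff : (p.1 < p.2 ∧ ¬ (p.2 : ℕ) < N - 1) ↔ ((p.1 : ℕ) < N - 1 ∧ (p.2 : ℕ) = N - 1) := by
      have := p.2.2
      rw [Fin.lt_def]
      omega
    simp only [hiff, cavCoef]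
    split_ifs with h
    · rw [spinLast_eq hN, show p.2 = ⟨N - 1, Nat.sub_lt hN Nat.one_pos⟩ from Fin.ext h.2]
      ring
    · simp
  rw [h1, ham, hamCav, ← mul_add, ← Finset.filter_filter, ← Finset.filter_filter,
    Finset.sum_filter_add_sum_filter_not]

lemma hamTS_one (hN : 0 < N) (g g' : Fin N × Fin N → ℝ) (σ : Config N) :
    hamTS N β t 1 g g' σ = ham N β (mixDisorder t g g') σ := by
  rw [hamTS, Real.sqrt_one, one_mul, cavField_eq hN, ham_eq hN]
  unfold hamCav mixDisorder
  simp only [Finset.mul_sum, mul_add, add_mul, Finset.sum_add_distrib]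
  congr 1 <;> congr 1 <;> exact Finset.sum_congr rfl fun p _ => by ring

/-- The average of a function of two pairs of independent configurations, drawn from the Gibbs
measures with disorders `x` and `y`. -/
def pairAvg (N : ℕ) (β : ℝ) (x y : Fin N × Fin N → ℝ)
    (f : Config N × Config N → Config N × Config N → ℝ) : ℝ :=
  ∑ ρ₁ : Config N × Config N, ∑ ρ₂ : Config N × Config N,
    f ρ₁ ρ₂ * (gibbsProb N β x ρ₁.1 * gibbsProb N β y ρ₁.2) *
      (gibbsProb N β x ρ₂.1 * gibbsProb N β y ρ₂.2)

/-- The average of a function of two independent configurations drawn from the Gibbs measures with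
disorders `x` and `y`. -/
def crossAvg (N : ℕ) (β : ℝ) (x y : Fin N × Fin N → ℝ) (Φ : Config N → Config N → ℝ) : ℝ :=
  ∑ σ, ∑ τ, Φ σ τ * gibbsProb N β x σ * gibbsProb N β y τ

lemma gibbsTS2_one (hN : 0 < N) (g g' g'' : Fin N × Fin N → ℝ)
    (f : Config N × Config N → Config N × Config N → ℝ) :
    gibbsTS2 N β t 1 g g' g'' f =
      pairAvg N β (mixDisorder t g g') (mixDisorder t g g'') f := by
  set x := mixDisorder t g g' with hx
  set y := mixDisorder t g g'' with hy
  have hZx := (partFun_pos (β := β) x).ne'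
  have hZy := (partFun_pos (β := β) y).ne'
  have hw : ∀ ρ, wTS N β t 1 g g' g'' ρ = partFun N β x * partFun N β y *
      (gibbsProb N β x ρ.1 * gibbsProb N β y ρ.2) := fun ρ => by
    rw [wTS, hamTS_one hN, hamTS_one hN, ← hx, ← hy, exp_add, gibbsProb, gibbsProb]
    field_simp
  have hs : ∑ ρ : Config N × Config N, gibbsProb N β x ρ.1 * gibbsProb N β y ρ.2 = 1 := by
    simp only [Fintype.sum_prod_type, ← Finset.mul_sum, sum_gibbsProb, mul_one]
  have h2 : ∀ a b c Z : ℝ, a * (Z * b) * (Z * c) = Z ^ 2 * (a * b * c) := fun _ _ _ _ => by ring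
  unfold gibbsTS2 pairAvg
  simp only [hw, h2, ← Finset.mul_sum, hs, mul_one]
  rw [mul_div_cancel_left₀ _ (pow_ne_zero 2 (mul_ne_zero hZx hZy))]

lemma gibbs2_eq (g : Fin N × Fin N → ℝ) (Φ : Config N → Config N → ℝ) :
    gibbs2 N β g Φ = crossAvg N β g g Φ := by
  unfold gibbs2 crossAvg gibbsProb
  simp only [Finset.sum_div]
  refine Finset.sum_congr rfl fun σ _ => Finset.sum_congr rfl fun τ _ => ?_
  rw [exp_add]
  have := (partFun_pos (β := β) g).ne'
  field_simp

lemma pairAvg_marginals (x y : Fin N × Fin N → ℝ) (Φ : Config N → Config N → ℝ) :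
    pairAvg N β x y (fun ρ₁ ρ₂ => Φ ρ₁.1 ρ₂.1) = crossAvg N β x x Φ ∧
    pairAvg N β x y (fun ρ₁ ρ₂ => Φ ρ₁.2 ρ₂.2) = crossAvg N β y y Φ ∧
    pairAvg N β x y (fun ρ₁ _ => Φ ρ₁.1 ρ₁.2) = crossAvg N β x y Φ ∧
    pairAvg N β x y (fun _ ρ₂ => Φ ρ₂.1 ρ₂.2) = crossAvg N β x y Φ ∧
    pairAvg N β x y (fun ρ₁ ρ₂ => Φ ρ₁.1 ρ₂.2) = crossAvg N β x y Φ ∧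
    pairAvg N β x y (fun ρ₁ ρ₂ => Φ ρ₂.1 ρ₁.2) = crossAvg N β x y Φ := by
  have key : ∀ a b c d : Config N, ∀ r : ℝ,
      r * (gibbsProb N β x a * gibbsProb N β y b) * (gibbsProb N β x c * gibbsProb N β y d) =
      gibbsProb N β x a * (gibbsProb N β y b * (gibbsProb N β x c * (gibbsProb N β y d * r))) :=
    fun _ _ _ _ _ => by ring
  have hx := sum_gibbsProb (β := β) x
  have hy := sum_gibbsProb (β := β) y
  have key₂ : ∀ a b r : ℝ, r * a * b = a * (b * r) := fun _ _ _ => by ring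
  unfold pairAvg crossAvg
  simp only [Fintype.sum_prod_type, key]
  simp only [key₂, ← Finset.mul_sum, ← Finset.sum_mul, hx, hy, one_mul, true_and]
  simp only [Finset.mul_sum]
  rw [Finset.sum_comm]
  exact Finset.sum_congr rfl fun σ _ => Finset.sum_congr rfl fun τ _ => by ring

instance (N : ℕ) : IsProbabilityMeasure (disM3 N) := by
  unfold disM3; infer_instance

@[fun_prop]
lemma measurable_mixDisorder_fst : Measurable fun ω : Disorder N => mixDisorder t ω.1 ω.2.1 := by
  unfold mixDisorder; fun_prop

@[fun_prop]
lemma measurable_mixDisorder_snd : Measurable fun ω : Disorder N => mixDisorder t ω.1 ω.2.2 := by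
  unfold mixDisorder; fun_prop

/-- The probability of a configuration of two pairs under the averaged coupled Gibbs measure. -/
def coupledProb (N : ℕ) (β t : ℝ) (ρ₁ ρ₂ : Config N × Config N) (ω : Disorder N) : ℝ :=
  gibbsProb N β (mixDisorder t ω.1 ω.2.1) ρ₁.1 * gibbsProb N β (mixDisorder t ω.1 ω.2.2) ρ₁.2 *
    (gibbsProb N β (mixDisorder t ω.1 ω.2.1) ρ₂.1 * gibbsProb N β (mixDisorder t ω.1 ω.2.2) ρ₂.2)

lemma coupledProb_nonneg (ρ₁ ρ₂ : Config N × Config N) (ω : Disorder N) :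
    0 ≤ coupledProb N β t ρ₁ ρ₂ ω :=
  mul_nonneg (mul_nonneg (gibbsProb_nonneg _ _) (gibbsProb_nonneg _ _))
    (mul_nonneg (gibbsProb_nonneg _ _) (gibbsProb_nonneg _ _))

lemma integrable_coupledProb (ρ₁ ρ₂ : Config N × Config N) :
    Integrable (coupledProb N β t ρ₁ ρ₂) (disM3 N) := by
  have hm : Measurable (coupledProb N β t ρ₁ ρ₂) := by
    unfold coupledProb
    exact ((((measurable_gibbsProb _).comp measurable_mixDisorder_fst).mul
      ((measurable_gibbsProb _).comp measurable_mixDisorder_snd)).mul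
      (((measurable_gibbsProb _).comp measurable_mixDisorder_fst).mul
      ((measurable_gibbsProb _).comp measurable_mixDisorder_snd)))
  refine Integrable.of_bound hm.aestronglyMeasurable 1 (.of_forall fun ω => ?_)
  rw [Real.norm_eq_abs, abs_of_nonneg (coupledProb_nonneg _ _ _)]
  have h := mul_le_one₀ (gibbsProb_le_one (β := β) (mixDisorder t ω.1 ω.2.1) ρ₁.1)
    (gibbsProb_nonneg _ _) (gibbsProb_le_one (β := β) (mixDisorder t ω.1 ω.2.2) ρ₁.2)
  have h' := mul_le_one₀ (gibbsProb_le_one (β := β) (mixDisorder t ω.1 ω.2.1) ρ₂.1)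
    (gibbsProb_nonneg _ _) (gibbsProb_le_one (β := β) (mixDisorder t ω.1 ω.2.2) ρ₂.2)
  exact mul_le_one₀ h (mul_nonneg (gibbsProb_nonneg _ _) (gibbsProb_nonneg _ _)) h'

lemma EgibbsTS2_one_eq_integral (hN : 0 < N)
    (f : Config N × Config N → Config N × Config N → ℝ) :
    EgibbsTS2 N β t 1 f =
      ∫ ω, pairAvg N β (mixDisorder t ω.1 ω.2.1) (mixDisorder t ω.1 ω.2.2) f ∂disM3 N := by
  simp only [EgibbsTS2, gibbsTS2_one hN]

lemma EgibbsTS2_one_eq_sum (hN : 0 < N)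
    (f : Config N × Config N → Config N × Config N → ℝ) :
    EgibbsTS2 N β t 1 f =
      ∑ ρ₁, ∑ ρ₂, (∫ ω, coupledProb N β t ρ₁ ρ₂ ω ∂disM3 N) * f ρ₁ ρ₂ := by
  rw [EgibbsTS2_one_eq_integral hN]
  simp only [← integral_mul_const]
  have hi := fun ρ₁ ρ₂ : Config N × Config N =>
    (integrable_coupledProb (β := β) (t := t) ρ₁ ρ₂).mul_const (f ρ₁ ρ₂)
  simp only [← integral_finsetSum _ fun ρ₂ _ => hi _ ρ₂]
  rw [← integral_finsetSum _ fun ρ₁ _ => integrable_finsetSum _ fun ρ₂ _ => hi ρ₁ ρ₂]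
  congr 1
  ext ω
  unfold pairAvg coupledProb
  exact Finset.sum_congr rfl fun ρ₁ _ => Finset.sum_congr rfl fun ρ₂ _ => by ring

variable {f f' : Config N × Config N → Config N × Config N → ℝ}

lemma EgibbsTS2_one_mono (hN : 0 < N) (h : ∀ ρ₁ ρ₂, f ρ₁ ρ₂ ≤ f' ρ₁ ρ₂) :
    EgibbsTS2 N β t 1 f ≤ EgibbsTS2 N β t 1 f' := by
  rw [EgibbsTS2_one_eq_sum hN, EgibbsTS2_one_eq_sum hN]
  exact Finset.sum_le_sum fun ρ₁ _ => Finset.sum_le_sum fun ρ₂ _ =>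
    mul_le_mul_of_nonneg_left (h _ _) (integral_nonneg fun ω => coupledProb_nonneg _ _ ω)

lemma EgibbsTS2_one_add (hN : 0 < N) :
    EgibbsTS2 N β t 1 (fun ρ₁ ρ₂ => f ρ₁ ρ₂ + f' ρ₁ ρ₂) =
      EgibbsTS2 N β t 1 f + EgibbsTS2 N β t 1 f' := by
  simp only [EgibbsTS2_one_eq_sum hN, mul_add, Finset.sum_add_distrib]

lemma EgibbsTS2_one_const_mul (hN : 0 < N) (c : ℝ) :
    EgibbsTS2 N β t 1 (fun ρ₁ ρ₂ => c * f ρ₁ ρ₂) = c * EgibbsTS2 N β t 1 f := by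
  simp only [EgibbsTS2_one_eq_sum hN, Finset.mul_sum]
  exact Finset.sum_congr rfl fun _ _ => Finset.sum_congr rfl fun _ _ => by ring

lemma EgibbsTS2_one_const (hN : 0 < N) (c : ℝ) :
    EgibbsTS2 N β t 1 (fun _ _ => c) = c := by
  have h : ∀ x y : Fin N × Fin N → ℝ, pairAvg N β x y (fun _ _ => c) = c := fun x y => by
    rw [(pairAvg_marginals x y fun _ _ => c).1]
    simp only [crossAvg, ← Finset.mul_sum, sum_gibbsProb, mul_one]
  rw [EgibbsTS2_one_eq_integral hN]
  simp [h]

lemma EgibbsTS2_one_sum (hN : 0 < N) {ι : Type*} (s : Finset ι)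
    (F : ι → Config N × Config N → Config N × Config N → ℝ) :
    EgibbsTS2 N β t 1 (fun ρ₁ ρ₂ => ∑ i ∈ s, F i ρ₁ ρ₂) = ∑ i ∈ s, EgibbsTS2 N β t 1 (F i) := by
  classical
  induction s using Finset.induction_on with
  | empty => simp [EgibbsTS2_one_const hN]
  | insert i s hi ih => simp only [Finset.sum_insert hi, EgibbsTS2_one_add hN, ih]

lemma EgibbsTS2_one_mul_self_nonneg (hN : 0 < N) (φ : Config N × Config N → ℝ) :
    0 ≤ EgibbsTS2 N β t 1 (fun ρ₁ ρ₂ => φ ρ₁ * φ ρ₂) := by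
  rw [EgibbsTS2_one_eq_integral hN]
  refine integral_nonneg fun ω => ?_
  have : ∀ x y : Fin N × Fin N → ℝ, pairAvg N β x y (fun ρ₁ ρ₂ => φ ρ₁ * φ ρ₂) =
      (∑ ρ : Config N × Config N, φ ρ * (gibbsProb N β x ρ.1 * gibbsProb N β y ρ.2)) *
      ∑ ρ : Config N × Config N, φ ρ * (gibbsProb N β x ρ.1 * gibbsProb N β y ρ.2) := fun x y => by
    rw [Finset.sum_mul_sum, pairAvg]
    exact Finset.sum_congr rfl fun _ _ => Finset.sum_congr rfl fun _ _ => by ring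
  simp only [this]
  exact mul_self_nonneg _

lemma measurePreserving_mixDisorder_fst (ht : t ∈ Set.Icc (0 : ℝ) 1) :
    MeasurePreserving (fun ω : Disorder N => mixDisorder t ω.1 ω.2.1) (disM3 N) (gaussPi N) := by
  have h : √t ^ 2 + √(1 - t) ^ 2 = 1 := by
    rw [Real.sq_sqrt ht.1, Real.sq_sqrt (by linarith [ht.2])]; ring
  exact (measurePreserving_rotation (Fin N × Fin N) h).comp
    ((MeasurePreserving.id (gaussPi N)).prod
      (measurePreserving_fst (μ := gaussPi N) (ν := gaussPi N)))

lemma measurePreserving_mixDisorder_snd (ht : t ∈ Set.Icc (0 : ℝ) 1) :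
    MeasurePreserving (fun ω : Disorder N => mixDisorder t ω.1 ω.2.2) (disM3 N) (gaussPi N) := by
  have h : √t ^ 2 + √(1 - t) ^ 2 = 1 := by
    rw [Real.sq_sqrt ht.1, Real.sq_sqrt (by linarith [ht.2])]; ring
  exact (measurePreserving_rotation (Fin N × Fin N) h).comp
    ((MeasurePreserving.id (gaussPi N)).prod
      (measurePreserving_snd (μ := gaussPi N) (ν := gaussPi N)))

lemma measurable_crossAvg_self (Φ : Config N → Config N → ℝ) :
    Measurable fun g => crossAvg N β g g Φ := by
  unfold crossAvg
  fun_prop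

lemma EgibbsTS2_one_fst (hN : 0 < N) (ht : t ∈ Set.Icc (0 : ℝ) 1) (Φ : Config N → Config N → ℝ) :
    EgibbsTS2 N β t 1 (fun ρ₁ ρ₂ => Φ ρ₁.1 ρ₂.1) = Egibbs2 N β Φ := by
  simp only [EgibbsTS2_one_eq_integral hN, (pairAvg_marginals _ _ Φ).1, Egibbs2, gibbs2_eq]
  rw [← (measurePreserving_mixDisorder_fst ht).map_eq, integral_map
    measurable_mixDisorder_fst.aemeasurable (measurable_crossAvg_self Φ).aestronglyMeasurable]

lemma EgibbsTS2_one_snd (hN : 0 < N) (ht : t ∈ Set.Icc (0 : ℝ) 1) (Φ : Config N → Config N → ℝ) :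
    EgibbsTS2 N β t 1 (fun ρ₁ ρ₂ => Φ ρ₁.2 ρ₂.2) = Egibbs2 N β Φ := by
  simp only [EgibbsTS2_one_eq_integral hN, (pairAvg_marginals _ _ Φ).2.1, Egibbs2, gibbs2_eq]
  rw [← (measurePreserving_mixDisorder_snd ht).map_eq, integral_map
    measurable_mixDisorder_snd.aemeasurable (measurable_crossAvg_self Φ).aestronglyMeasurable]

/-- Positive semidefiniteness of the powers of the overlap. -/
lemma crossAvg_ovlp_pow_le (k : ℕ) (x y : Fin N × Fin N → ℝ) :
    2 * crossAvg N β x y (fun σ τ => ovlp N σ τ ^ k) ≤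
      crossAvg N β x x (fun σ τ => ovlp N σ τ ^ k) +
        crossAvg N β y y (fun σ τ => ovlp N σ τ ^ k) := by
  let φ : (Fin k → Fin N) → (Fin N × Fin N → ℝ) → ℝ := fun I x =>
    ∑ σ, (∏ l, spin (σ (I l))) * gibbsProb N β x σ
  have h : ∀ x y, crossAvg N β x y (fun σ τ => ovlp N σ τ ^ k) =
      (∑ I, φ I x * φ I y) / (N : ℝ) ^ k := fun x y => by
    have hR : ∀ σ τ : Config N, ovlp N σ τ ^ k =
        ∑ I : Fin k → Fin N, (∏ l, spin (σ (I l))) * (∏ l, spin (τ (I l))) / (N : ℝ) ^ k :=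
      fun σ τ => by
        rw [ovlp, div_pow, Fintype.sum_pow, Finset.sum_div]
        simp only [Finset.prod_mul_distrib]
    simp only [crossAvg, hR, φ, Finset.sum_mul, Finset.mul_sum, Finset.sum_div]
    symm
    conv_rhs => rw [Finset.sum_comm]
    rw [Finset.sum_comm]
    refine Finset.sum_congr rfl fun σ _ => ?_
    rw [Finset.sum_comm]
    exact Finset.sum_congr rfl fun τ _ => Finset.sum_congr rfl fun I _ => by ring
  simp only [h]
  rw [← add_div, ← mul_div_assoc]
  refine div_le_div_of_nonneg_right ?_ (by positivity)
  rw [Finset.mul_sum, ← Finset.sum_add_distrib]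
  exact Finset.sum_le_sum fun I _ => by nlinarith [sq_nonneg (φ I x - φ I y)]

lemma integrable_pairAvg :
    Integrable (fun ω => pairAvg N β (mixDisorder t ω.1 ω.2.1) (mixDisorder t ω.1 ω.2.2) f)
      (disM3 N) := by
  unfold pairAvg
  refine integrable_finsetSum _ fun ρ₁ _ => integrable_finsetSum _ fun ρ₂ _ => ?_
  refine ((integrable_coupledProb (β := β) (t := t) ρ₁ ρ₂).const_mul (f ρ₁ ρ₂)).congr
    (.of_forall fun ω => ?_)
  simp only [coupledProb]
  ring

lemma EgibbsTS2_one_ovlp_pow_le (hN : 0 < N) (ht : t ∈ Set.Icc (0 : ℝ) 1) (k : ℕ) :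
    EgibbsTS2 N β t 1 (fun ρ₁ _ => ovlp N ρ₁.1 ρ₁.2 ^ k) ≤
      Egibbs2 N β (fun σ τ => ovlp N σ τ ^ k) := by
  have h1 := EgibbsTS2_one_fst (β := β) hN ht (fun σ τ => ovlp N σ τ ^ k)
  have h2 := EgibbsTS2_one_snd (β := β) hN ht (fun σ τ => ovlp N σ τ ^ k)
  have h3 : 2 * EgibbsTS2 N β t 1 (fun ρ₁ _ => ovlp N ρ₁.1 ρ₁.2 ^ k) ≤
      EgibbsTS2 N β t 1 (fun ρ₁ ρ₂ => ovlp N ρ₁.1 ρ₂.1 ^ k) +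
        EgibbsTS2 N β t 1 (fun ρ₁ ρ₂ => ovlp N ρ₁.2 ρ₂.2 ^ k) := by
    simp only [EgibbsTS2_one_eq_integral hN]
    rw [← integral_const_mul, ← integral_add integrable_pairAvg integrable_pairAvg]
    refine integral_mono (integrable_pairAvg.const_mul _)
      (integrable_pairAvg.add integrable_pairAvg) fun ω => ?_
    have hm := pairAvg_marginals (β := β) (mixDisorder t ω.1 ω.2.1) (mixDisorder t ω.1 ω.2.2)
      (fun σ τ => ovlp N σ τ ^ k)
    simp only [hm.1, hm.2.1, hm.2.2.1]
    exact crossAvg_ovlp_pow_le k _ _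
  linarith

lemma EgibbsTS2_one_cross (hN : 0 < N) (Φ : Config N → Config N → ℝ) :
    EgibbsTS2 N β t 1 (fun _ ρ₂ => Φ ρ₂.1 ρ₂.2) = EgibbsTS2 N β t 1 (fun ρ₁ _ => Φ ρ₁.1 ρ₁.2) ∧
    EgibbsTS2 N β t 1 (fun ρ₁ ρ₂ => Φ ρ₁.1 ρ₂.2) = EgibbsTS2 N β t 1 (fun ρ₁ _ => Φ ρ₁.1 ρ₁.2) ∧
    EgibbsTS2 N β t 1 (fun ρ₁ ρ₂ => Φ ρ₂.1 ρ₁.2) =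
      EgibbsTS2 N β t 1 (fun ρ₁ _ => Φ ρ₁.1 ρ₁.2) := by
  simp only [EgibbsTS2_one_eq_integral hN, (pairAvg_marginals _ _ Φ).2.2.1,
    (pairAvg_marginals _ _ Φ).2.2.2.1, (pairAvg_marginals _ _ Φ).2.2.2.2.1,
    (pairAvg_marginals _ _ Φ).2.2.2.2.2, and_self]

/-- Conditionally on the common disorder, the two configurations of a pair are i.i.d. -/
lemma EgibbsTS2_one_tensor_nonneg (hN : 0 < N) (φ : Config N → ℝ) :
    0 ≤ EgibbsTS2 N β t 1 (fun ρ₁ _ => φ ρ₁.1 * φ ρ₁.2) := by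
  let ψ : (Fin N × Fin N → ℝ) → ℝ := fun x => ∑ σ, φ σ * gibbsProb N β x σ
  have h : ∀ x y, pairAvg N β x y (fun ρ₁ _ => φ ρ₁.1 * φ ρ₁.2) = ψ x * ψ y := fun x y => by
    rw [(pairAvg_marginals x y fun σ τ => φ σ * φ τ).2.2.1]
    simp only [crossAvg, ψ, Finset.sum_mul_sum]
    exact Finset.sum_congr rfl fun _ _ => Finset.sum_congr rfl fun _ _ => by ring
  have hi := integrable_pairAvg (β := β) (t := t) (f := fun ρ₁ (_ : Config N × Config N) =>
    φ ρ₁.1 * φ ρ₁.2)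
  rw [EgibbsTS2_one_eq_integral hN]
  simp only [h] at hi ⊢
  unfold disM3 at hi ⊢
  rw [integral_prod _ hi]
  refine integral_nonneg fun g => ?_
  simp only
  rw [integral_prod_mul (fun g' => ψ (mixDisorder t g g')) (fun g' => ψ (mixDisorder t g g'))]
  exact mul_self_nonneg _

lemma one_div_le_EgibbsTS2_one_ovlp_sq (hN : 0 < N) :
    1 / (N : ℝ) ≤ EgibbsTS2 N β t 1 (fun ρ₁ _ => ovlp N ρ₁.1 ρ₁.2 ^ 2) := by
  have h0 : (0 : ℝ) < N := by exact_mod_cast hN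
  let φ : Fin N → Fin N → Config N → ℝ := fun i j σ => spin (σ i) * spin (σ j)
  have h : ∀ σ τ : Config N, ovlp N σ τ ^ 2 =
      ∑ i, ∑ j, (1 / (N : ℝ) ^ 2) * (φ i j σ * φ i j τ) := fun σ τ => by
    rw [ovlp, div_pow, sq (∑ i, _), Finset.sum_mul_sum, Finset.sum_div]
    refine Finset.sum_congr rfl fun i _ => ?_
    rw [Finset.sum_div]
    exact Finset.sum_congr rfl fun j _ => by simp only [φ]; ring
  have hsum : EgibbsTS2 N β t 1 (fun ρ₁ _ => ovlp N ρ₁.1 ρ₁.2 ^ 2) =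
      ∑ i, ∑ j, 1 / (N : ℝ) ^ 2 *
        EgibbsTS2 N β t 1 (fun ρ₁ _ => φ i j ρ₁.1 * φ i j ρ₁.2) := by
    simp only [h, EgibbsTS2_one_sum hN, EgibbsTS2_one_const_mul hN]
  rw [hsum]
  calc 1 / (N : ℝ) = ∑ i : Fin N, 1 / (N : ℝ) ^ 2 * 1 := by
        simp; field_simp
    _ ≤ _ := Finset.sum_le_sum fun i _ => by
        refine le_trans (le_of_eq ?_) (Finset.single_le_sum (fun j _ => mul_nonneg (by positivity)
          (EgibbsTS2_one_tensor_nonneg hN (φ i j))) (Finset.mem_univ i))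
        simp only [φ, spin_mul_self, mul_one, EgibbsTS2_one_const hN]

end Coupled

section Moments

variable {N : ℕ} {β t : ℝ}

lemma inv_sq_le_EgibbsTS2_one (hN : 0 < N) :
    (1 / (N : ℝ)) ^ 2 ≤ EgibbsTS2 N β t 1
      (fun ρ₁ ρ₂ => ovlp N ρ₁.1 ρ₁.2 ^ 2 * ovlp N ρ₂.1 ρ₂.2 ^ 2) := by
  have h := EgibbsTS2_one_mul_self_nonneg (β := β) (t := t) hN
    (fun ρ => ovlp N ρ.1 ρ.2 ^ 2 - 1 / (N : ℝ))
  have he : ∀ ρ₁ ρ₂ : Config N × Config N, (ovlp N ρ₁.1 ρ₁.2 ^ 2 - 1 / (N : ℝ)) *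
      (ovlp N ρ₂.1 ρ₂.2 ^ 2 - 1 / (N : ℝ)) =
      ovlp N ρ₁.1 ρ₁.2 ^ 2 * ovlp N ρ₂.1 ρ₂.2 ^ 2 + (-(1 / (N : ℝ)) * ovlp N ρ₁.1 ρ₁.2 ^ 2 +
      (-(1 / (N : ℝ)) * ovlp N ρ₂.1 ρ₂.2 ^ 2 + (1 / (N : ℝ)) ^ 2)) := fun _ _ => by ring
  simp only [he, EgibbsTS2_one_add hN, EgibbsTS2_one_const_mul hN, EgibbsTS2_one_const hN,
    (EgibbsTS2_one_cross hN fun σ τ => ovlp N σ τ ^ 2).1] at h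
  have h1 := one_div_le_EgibbsTS2_one_ovlp_sq (β := β) (t := t) hN
  have h0 : (0 : ℝ) ≤ 1 / N := by positivity
  nlinarith

lemma inv_pow_six_le_Egibbs2 (hN : 0 < N) (ht : t ∈ Set.Icc (0 : ℝ) 1) :
    (1 / (N : ℝ)) ^ 6 ≤ Egibbs2 N β (fun σ τ => ovlp N σ τ ^ 12) := by
  refine le_trans ?_ (EgibbsTS2_one_ovlp_pow_le hN ht 12)
  have h0 : (0 : ℝ) ≤ 1 / N := by positivity
  set a := 1 / (N : ℝ) with ha
  have hp : ∀ r : ℝ, 6 * a ^ 5 * r ^ 2 + -5 * a ^ 6 ≤ r ^ 12 := fun r => by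
    have hy : 0 ≤ r ^ 2 := sq_nonneg r
    set y := r ^ 2
    have : r ^ 12 = y ^ 6 := by simp only [y]; ring
    rw [this]
    have : y ^ 6 - (6 * a ^ 5 * y + -5 * a ^ 6) =
        (y - a) ^ 2 * (y ^ 4 + 2 * y ^ 3 * a + 3 * y ^ 2 * a ^ 2 + 4 * y * a ^ 3 + 5 * a ^ 4) := by
      ring
    have : 0 ≤ (y - a) ^ 2 *
        (y ^ 4 + 2 * y ^ 3 * a + 3 * y ^ 2 * a ^ 2 + 4 * y * a ^ 3 + 5 * a ^ 4) := by positivity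
    linarith
  refine le_trans ?_ (EgibbsTS2_one_mono hN fun ρ₁ _ => hp (ovlp N ρ₁.1 ρ₁.2))
  rw [EgibbsTS2_one_add hN, EgibbsTS2_one_const_mul hN, EgibbsTS2_one_const hN]
  have h1 := one_div_le_EgibbsTS2_one_ovlp_sq (β := β) (t := t) hN
  rw [← ha] at h1
  have h2 := mul_le_mul_of_nonneg_left h1 (by positivity : 0 ≤ 6 * a ^ 5)
  nlinarith

variable {b : ℝ}

lemma inv_sq_le_of_pow_eq (hN : 0 < N) (ht : t ∈ Set.Icc (0 : ℝ) 1) (hb0 : 0 ≤ b)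
    (hb : b ^ 3 = Egibbs2 N β (fun σ τ => ovlp N σ τ ^ 12)) : (1 / (N : ℝ)) ^ 2 ≤ b := by
  refine le_of_pow_le_pow_left₀ (n := 3) (by norm_num) hb0 ?_
  rw [hb, ← pow_mul]
  exact inv_pow_six_le_Egibbs2 hN ht

lemma Egibbs2_ovlp_le (hN : 0 < N) (hb0 : 0 < b)
    (hb : b ^ 3 = Egibbs2 N β (fun σ τ => ovlp N σ τ ^ 12)) :
    Egibbs2 N β (fun σ τ => ovlp N σ τ ^ 4) ≤ b ∧
      Egibbs2 N β (fun σ τ => ovlp N σ τ ^ 8) ≤ b ^ 2 := by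
  have h1 : (1 : ℝ) ∈ Set.Icc (0 : ℝ) 1 := ⟨zero_le_one, le_rfl⟩
  simp only [← EgibbsTS2_one_fst hN h1] at hb ⊢
  have hp : ∀ r : ℝ, r ^ 4 ≤ 1 / (3 * b ^ 2) * r ^ 12 + 2 / 3 * b ∧
      r ^ 8 ≤ 2 / (3 * b) * r ^ 12 + b ^ 2 / 3 := fun r => by
    have hz : 0 ≤ r ^ 4 := by positivity
    have h12 : r ^ 12 = (r ^ 4) ^ 3 := by ring
    have h8 : r ^ 8 = (r ^ 4) ^ 2 := by ring
    rw [h12, h8]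
    generalize r ^ 4 = z at hz
    constructor
    · have : 1 / (3 * b ^ 2) * z ^ 3 + 2 / 3 * b - z =
          (z - b) ^ 2 * (z + 2 * b) / (3 * b ^ 2) := by field_simp; ring
      have : 0 ≤ (z - b) ^ 2 * (z + 2 * b) / (3 * b ^ 2) := by positivity
      linarith
    · have : 2 / (3 * b) * z ^ 3 + b ^ 2 / 3 - z ^ 2 =
          (z - b) ^ 2 * (2 * z + b) / (3 * b) := by field_simp; ring
      have : 0 ≤ (z - b) ^ 2 * (2 * z + b) / (3 * b) := by positivity
      linarith
  constructor
  · refine (EgibbsTS2_one_mono hN fun ρ₁ ρ₂ => (hp (ovlp N ρ₁.1 ρ₂.1)).1).trans (le_of_eq ?_)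
    rw [EgibbsTS2_one_add hN, EgibbsTS2_one_const_mul hN, EgibbsTS2_one_const hN, ← hb]
    field_simp
    ring
  · refine (EgibbsTS2_one_mono hN fun ρ₁ ρ₂ => (hp (ovlp N ρ₁.1 ρ₂.1)).2).trans (le_of_eq ?_)
    rw [EgibbsTS2_one_add hN, EgibbsTS2_one_const_mul hN, EgibbsTS2_one_const hN, ← hb]
    field_simp
    ring

lemma EgibbsTS2_one_sq_mul_sq_le (hN : 0 < N) (ht : t ∈ Set.Icc (0 : ℝ) 1) (hb0 : 0 < b)
    (hb : b ^ 3 = Egibbs2 N β (fun σ τ => ovlp N σ τ ^ 12)) :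
    EgibbsTS2 N β t 1 (fun ρ₁ ρ₂ => ovlp N ρ₁.1 ρ₁.2 ^ 2 * ovlp N ρ₂.1 ρ₂.2 ^ 2) ≤ b := by
  have hp : ∀ r s : ℝ, r ^ 2 * s ^ 2 ≤ 1 / 2 * r ^ 4 + 1 / 2 * s ^ 4 := fun r s => by
    nlinarith [sq_nonneg (r ^ 2 - s ^ 2)]
  have h := EgibbsTS2_one_mono (β := β) (t := t) hN
    fun ρ₁ ρ₂ => hp (ovlp N ρ₁.1 ρ₁.2) (ovlp N ρ₂.1 ρ₂.2)
  rw [EgibbsTS2_one_add hN, EgibbsTS2_one_const_mul hN, EgibbsTS2_one_const_mul hN,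
    (EgibbsTS2_one_cross hN fun σ τ => ovlp N σ τ ^ 4).1] at h
  have h1 := EgibbsTS2_one_ovlp_pow_le (β := β) hN ht 4
  have h2 := (Egibbs2_ovlp_le hN hb0 hb).1
  linarith

lemma ovlpm_pow_eight_le (hN : 0 < N) (σ τ : Config N) :
    ovlpm N σ τ ^ 8 ≤ 128 * ovlp N σ τ ^ 8 + 128 * (1 / (N : ℝ)) ^ 8 := by
  have h : ovlpm N σ τ = ovlp N σ τ + -(spinLast σ * spinLast τ / N) := by
    rw [ovlp_eq hN]; ring
  have h2 := Even.add_pow_le (n := 8) (by decide) (a := ovlp N σ τ)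
    (b := -(spinLast σ * spinLast τ / N))
  have h3 : (-(spinLast σ * spinLast τ / (N : ℝ))) ^ 8 = (1 / (N : ℝ)) ^ 8 := by
    have e1 := spinLast_mul_self hN σ
    have e2 := spinLast_mul_self hN τ
    calc _ = (spinLast σ * spinLast σ) ^ 4 * (spinLast τ * spinLast τ) ^ 4 * (1 / (N : ℝ)) ^ 8 := by
          ring
      _ = _ := by rw [e1, e2]; ring
  rw [← h, h3] at h2
  linarith

lemma ovlpm_sq_le (hN : 0 < N) (σ τ : Config N) :
    ovlpm N σ τ ^ 2 ≤ 2 * ovlp N σ τ ^ 2 + 2 * (1 / (N : ℝ)) ^ 2 := by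
  have h : ovlpm N σ τ = ovlp N σ τ + -(spinLast σ * spinLast τ / N) := by
    rw [ovlp_eq hN]; ring
  have h3 : (-(spinLast σ * spinLast τ / (N : ℝ))) ^ 2 = (1 / (N : ℝ)) ^ 2 := by
    have e1 := spinLast_mul_self hN σ
    have e2 := spinLast_mul_self hN τ
    calc _ = (spinLast σ * spinLast σ) * (spinLast τ * spinLast τ) * (1 / (N : ℝ)) ^ 2 := by
          ring
      _ = _ := by rw [e1, e2]; ring
  rw [← h3, h]
  nlinarith [sq_nonneg (ovlp N σ τ - -(spinLast σ * spinLast τ / N))]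

/-- The eighth moments of the truncated overlaps. -/
lemma EgibbsTS2_one_ovlpm_le (hN : 0 < N) (ht : t ∈ Set.Icc (0 : ℝ) 1) (hb0 : 0 < b)
    (hb : b ^ 3 = Egibbs2 N β (fun σ τ => ovlp N σ τ ^ 12))
    (π₁ π₂ : Config N × Config N → Config N × Config N → Config N)
    (hπ : EgibbsTS2 N β t 1 (fun ρ₁ ρ₂ => ovlp N (π₁ ρ₁ ρ₂) (π₂ ρ₁ ρ₂) ^ 8) ≤
      Egibbs2 N β (fun σ τ => ovlp N σ τ ^ 8)) :
    EgibbsTS2 N β t 1 (fun ρ₁ ρ₂ => ovlpm N (π₁ ρ₁ ρ₂) (π₂ ρ₁ ρ₂) ^ 8) ≤ 256 * b ^ 2 := by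
  have h := EgibbsTS2_one_mono (β := β) (t := t) hN
    fun ρ₁ ρ₂ => ovlpm_pow_eight_le hN (π₁ ρ₁ ρ₂) (π₂ ρ₁ ρ₂)
  rw [EgibbsTS2_one_add hN, EgibbsTS2_one_const_mul hN, EgibbsTS2_one_const hN] at h
  have h1 := (Egibbs2_ovlp_le hN hb0 hb).2
  have h2 := inv_sq_le_of_pow_eq hN ht hb0.le hb
  have h3 : (1 / (N : ℝ)) ^ 8 ≤ b ^ 2 := by
    have hN1 : (1 : ℝ) ≤ N := by exact_mod_cast hN
    have h4 : 1 / (N : ℝ) ≤ 1 := by rw [div_le_one] <;> linarith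
    calc (1 / (N : ℝ)) ^ 8 ≤ (1 / (N : ℝ)) ^ 4 :=
          pow_le_pow_of_le_one (by positivity) h4 (by norm_num)
      _ = ((1 / (N : ℝ)) ^ 2) ^ 2 := by ring
      _ ≤ b ^ 2 := pow_le_pow_left₀ (by positivity) h2 2
  linarith

end Moments

section Decoupling

variable {N : ℕ} {β t b : ℝ}

/-- The moments at `s = 1` that control the cavity interpolation. -/
lemma EgibbsTS2_one_second_order (hN : 0 < N) :
    EgibbsTS2 N β t 1 (fun ρ₁ ρ₂ => ovlpm N ρ₁.1 ρ₁.2 ^ 2 * ovlp N ρ₂.1 ρ₂.2 ^ 2) ≤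
        16 * EgibbsTS2 N β t 1 (fun ρ₁ ρ₂ => ovlp N ρ₁.1 ρ₁.2 ^ 2 * ovlp N ρ₂.1 ρ₂.2 ^ 2) ∧
      EgibbsTS2 N β t 1 (fun ρ₁ ρ₂ => ovlpm N ρ₁.1 ρ₁.2 ^ 2 * ovlpm N ρ₂.1 ρ₂.2 ^ 2) ≤
        16 * EgibbsTS2 N β t 1
          (fun ρ₁ ρ₂ => ovlp N ρ₁.1 ρ₁.2 ^ 2 * ovlp N ρ₂.1 ρ₂.2 ^ 2) := by
  have hN1 : (1 : ℝ) ≤ N := by exact_mod_cast hN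
  have ha1 : 1 / (N : ℝ) ≤ 1 := by rw [div_le_one] <;> linarith
  have ha0 : 0 ≤ 1 / (N : ℝ) := by positivity
  have ha2 : (1 / (N : ℝ)) ^ 2 ≤ 1 := pow_le_one₀ ha0 ha1
  have hX := inv_sq_le_EgibbsTS2_one (β := β) (t := t) hN
  have hsq : ∀ σ τ : Config N, ovlp N σ τ ^ 2 ≤ 1 := fun σ τ =>
    (sq_le_one_iff_abs_le_one _).2 (abs_ovlp_le hN σ τ)
  have hp : ∀ ρ₁ ρ₂ : Config N × Config N,
      ovlpm N ρ₁.1 ρ₁.2 ^ 2 * ovlp N ρ₂.1 ρ₂.2 ^ 2 ≤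
        4 * (ovlp N ρ₁.1 ρ₁.2 ^ 2 * ovlp N ρ₂.1 ρ₂.2 ^ 2) + 12 * (1 / (N : ℝ)) ^ 2 ∧
      ovlpm N ρ₁.1 ρ₁.2 ^ 2 * ovlpm N ρ₂.1 ρ₂.2 ^ 2 ≤
        4 * (ovlp N ρ₁.1 ρ₁.2 ^ 2 * ovlp N ρ₂.1 ρ₂.2 ^ 2) + 12 * (1 / (N : ℝ)) ^ 2 := by
    intro ρ₁ ρ₂
    have h1 := ovlpm_sq_le hN ρ₁.1 ρ₁.2
    have h2 := ovlpm_sq_le hN ρ₂.1 ρ₂.2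
    have s1 := hsq ρ₁.1 ρ₁.2
    have s2 := hsq ρ₂.1 ρ₂.2
    have p1 := sq_nonneg (ovlp N ρ₁.1 ρ₁.2)
    have p2 := sq_nonneg (ovlp N ρ₂.1 ρ₂.2)
    have p3 := sq_nonneg (ovlpm N ρ₁.1 ρ₁.2)
    have p4 := sq_nonneg (ovlpm N ρ₂.1 ρ₂.2)
    have p5 := sq_nonneg (1 / (N : ℝ))
    generalize ovlp N ρ₁.1 ρ₁.2 ^ 2 = r at *
    generalize ovlp N ρ₂.1 ρ₂.2 ^ 2 = s at *
    generalize ovlpm N ρ₁.1 ρ₁.2 ^ 2 = r' at *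
    generalize ovlpm N ρ₂.1 ρ₂.2 ^ 2 = s' at *
    generalize (1 / (N : ℝ)) ^ 2 = a at *
    constructor
    · have := mul_le_mul_of_nonneg_right h1 p2
      nlinarith [mul_nonneg p1 p2, mul_nonneg p5 (sub_nonneg.2 s2)]
    · have := mul_le_mul h1 h2 p4 (by linarith)
      nlinarith [mul_nonneg p5 (sub_nonneg.2 s2), mul_nonneg p5 (sub_nonneg.2 s1),
        mul_nonneg p5 (sub_nonneg.2 ha2)]
  have h1 := EgibbsTS2_one_mono (β := β) (t := t) hN fun ρ₁ ρ₂ => (hp ρ₁ ρ₂).1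
  have h2 := EgibbsTS2_one_mono (β := β) (t := t) hN fun ρ₁ ρ₂ => (hp ρ₁ ρ₂).2
  rw [EgibbsTS2_one_add hN, EgibbsTS2_one_const_mul hN, EgibbsTS2_one_const hN] at h1 h2
  constructor <;> linarith

lemma EgibbsTS2_one_ovlpm_marginals (hN : 0 < N) (ht : t ∈ Set.Icc (0 : ℝ) 1) (hb0 : 0 < b)
    (hb : b ^ 3 = Egibbs2 N β (fun σ τ => ovlp N σ τ ^ 12)) :
    EgibbsTS2 N β t 1 (fun ρ₁ _ => ovlpm N ρ₁.1 ρ₁.2 ^ 8) ≤ 256 * b ^ 2 ∧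
    EgibbsTS2 N β t 1 (fun _ ρ₂ => ovlpm N ρ₂.1 ρ₂.2 ^ 8) ≤ 256 * b ^ 2 ∧
    EgibbsTS2 N β t 1 (fun ρ₁ ρ₂ => ovlpm N ρ₁.1 ρ₂.1 ^ 8) ≤ 256 * b ^ 2 ∧
    EgibbsTS2 N β t 1 (fun ρ₁ ρ₂ => ovlpm N ρ₁.2 ρ₂.2 ^ 8) ≤ 256 * b ^ 2 ∧
    EgibbsTS2 N β t 1 (fun ρ₁ ρ₂ => ovlpm N ρ₁.1 ρ₂.2 ^ 8) ≤ 256 * b ^ 2 ∧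
    EgibbsTS2 N β t 1 (fun ρ₁ ρ₂ => ovlpm N ρ₁.2 ρ₂.1 ^ 8) ≤ 256 * b ^ 2 := by
  have hc := EgibbsTS2_one_cross (β := β) (t := t) hN fun σ τ => ovlp N σ τ ^ 8
  have h8 := EgibbsTS2_one_ovlp_pow_le (β := β) hN ht 8
  have main := EgibbsTS2_one_ovlpm_le (β := β) hN ht hb0 hb
  refine ⟨main (fun ρ₁ _ => ρ₁.1) (fun ρ₁ _ => ρ₁.2) h8,
    main (fun _ ρ₂ => ρ₂.1) (fun _ ρ₂ => ρ₂.2) (hc.1.trans_le h8),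
    main (fun ρ₁ _ => ρ₁.1) (fun _ ρ₂ => ρ₂.1)
      (EgibbsTS2_one_fst hN ht fun σ τ => ovlp N σ τ ^ 8).le,
    main (fun ρ₁ _ => ρ₁.2) (fun _ ρ₂ => ρ₂.2)
      (EgibbsTS2_one_snd hN ht fun σ τ => ovlp N σ τ ^ 8).le,
    main (fun ρ₁ _ => ρ₁.1) (fun _ ρ₂ => ρ₂.2) (hc.2.1.trans_le h8),
    main (fun ρ₁ _ => ρ₁.2) (fun _ ρ₂ => ρ₂.1) ?_⟩
  simp only [ovlp_comm (Prod.snd _)]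
  exact hc.2.2.trans_le h8

lemma Ufun_pow_eight_le (hN : 0 < N) (hβ : β ∈ Set.Ioc (0 : ℝ) 1) (ht : t ∈ Set.Icc (0 : ℝ) 1)
    (ρ₁ ρ₂ : Config N × Config N) :
    (2 * Ufun N β t ρ₁ ρ₂) ^ 8 ≤ 2 ^ 14 * (ovlpm N ρ₁.1 ρ₂.1 ^ 8 + (ovlpm N ρ₁.2 ρ₂.2 ^ 8 +
      (ovlpm N ρ₁.1 ρ₂.2 ^ 8 + ovlpm N ρ₁.2 ρ₂.1 ^ 8))) := by
  have hβ2 : β ^ 2 ≤ 1 := pow_le_one₀ hβ.1.le hβ.2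
  have hβt : β ^ 2 * t ≤ 1 := mul_le_one₀ hβ2 ht.1 ht.2
  have hβt0 : 0 ≤ β ^ 2 * t := mul_nonneg (sq_nonneg β) ht.1
  have key : ∀ (c : ℝ) (σ τ : Config N), 0 ≤ c → c ≤ 1 →
      (c * (spinLast σ * spinLast τ * ovlpm N σ τ)) ^ 8 ≤ ovlpm N σ τ ^ 8 := fun c σ τ h0 h1 => by
    have : (c * (spinLast σ * spinLast τ * ovlpm N σ τ)) ^ 8 =
        c ^ 8 * ((spinLast σ * spinLast σ) ^ 4 * (spinLast τ * spinLast τ) ^ 4 *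
          ovlpm N σ τ ^ 8) := by ring
    rw [this, spinLast_mul_self hN, spinLast_mul_self hN, one_pow, one_mul, one_mul]
    exact mul_le_of_le_one_left (by positivity) (pow_le_one₀ h0 h1)
  have he : Even 8 := by decide
  have h1 := key _ ρ₁.1 ρ₂.1 (sq_nonneg β) hβ2
  have h2 := key _ ρ₁.2 ρ₂.2 (sq_nonneg β) hβ2
  have h3 := key _ ρ₁.1 ρ₂.2 hβt0 hβt
  have h4 := key _ ρ₁.2 ρ₂.1 hβt0 hβt
  have hU : 2 * Ufun N β t ρ₁ ρ₂ =
      (β ^ 2 * (spinLast ρ₁.1 * spinLast ρ₂.1 * ovlpm N ρ₁.1 ρ₂.1) +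
        β ^ 2 * (spinLast ρ₁.2 * spinLast ρ₂.2 * ovlpm N ρ₁.2 ρ₂.2)) +
      (β ^ 2 * t * (spinLast ρ₁.1 * spinLast ρ₂.2 * ovlpm N ρ₁.1 ρ₂.2) +
        β ^ 2 * t * (spinLast ρ₁.2 * spinLast ρ₂.1 * ovlpm N ρ₁.2 ρ₂.1)) := by
    unfold Ufun; ring
  rw [hU]
  generalize β ^ 2 * (spinLast ρ₁.1 * spinLast ρ₂.1 * ovlpm N ρ₁.1 ρ₂.1) = x at *
  generalize β ^ 2 * (spinLast ρ₁.2 * spinLast ρ₂.2 * ovlpm N ρ₁.2 ρ₂.2) = y at *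
  generalize β ^ 2 * t * (spinLast ρ₁.1 * spinLast ρ₂.2 * ovlpm N ρ₁.1 ρ₂.2) = z at *
  generalize β ^ 2 * t * (spinLast ρ₁.2 * spinLast ρ₂.1 * ovlpm N ρ₁.2 ρ₂.1) = u at *
  have e1 := he.add_pow_le (a := x + y) (b := z + u)
  have e2 := he.add_pow_le (a := x) (b := y)
  have e3 := he.add_pow_le (a := z) (b := u)
  norm_num at e1 e2 e3 ⊢
  linarith

lemma pairVar_pow_eight_le (hN : 0 < N) (hβ : β ∈ Set.Ioc (0 : ℝ) 1) (ht : t ∈ Set.Icc (0 : ℝ) 1)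
    (ρ : Config N × Config N) : pairVar N β t ρ ^ 8 ≤ ovlpm N ρ.1 ρ.2 ^ 8 := by
  have hβ2 : β ^ 2 ≤ 1 := pow_le_one₀ hβ.1.le hβ.2
  have hβt : β ^ 2 * t ≤ 1 := mul_le_one₀ hβ2 ht.1 ht.2
  have hβt0 : 0 ≤ β ^ 2 * t := mul_nonneg (sq_nonneg β) ht.1
  have : pairVar N β t ρ ^ 8 =
      (β ^ 2 * t) ^ 8 * ((spinLast ρ.1 * spinLast ρ.1) ^ 4 * (spinLast ρ.2 * spinLast ρ.2) ^ 4 *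
        ovlpm N ρ.1 ρ.2 ^ 8) := by
    unfold pairVar; ring
  rw [this, spinLast_mul_self hN, spinLast_mul_self hN, one_pow, one_mul, one_mul]
  exact mul_le_of_le_one_left (by positivity) (pow_le_one₀ hβt0 hβt)

/-- The higher moments at `s = 1` that control the cavity interpolation. -/
lemma EgibbsTS2_one_fourth_order (hN : 0 < N) (hβ : β ∈ Set.Ioc (0 : ℝ) 1)
    (ht : t ∈ Set.Icc (0 : ℝ) 1) (hb0 : 0 < b)
    (hb : b ^ 3 = Egibbs2 N β (fun σ τ => ovlp N σ τ ^ 12)) :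
    EgibbsTS2 N β t 1 (fun ρ₁ ρ₂ => (ovlpm N ρ₁.1 ρ₁.2 ^ 2 * ovlp N ρ₂.1 ρ₂.2 ^ 2) ^ 2) ≤
        256 * b ^ 2 ∧
      EgibbsTS2 N β t 1 (fun ρ₁ ρ₂ => (2 * Ufun N β t ρ₁ ρ₂) ^ 8) ≤ 2 ^ 24 * b ^ 2 ∧
      EgibbsTS2 N β t 1 (fun ρ₁ _ => pairVar N β t ρ₁ ^ 8) ≤ 256 * b ^ 2 ∧
      EgibbsTS2 N β t 1 (fun ρ₁ ρ₂ => (1 / (N : ℝ)) ^ 2 *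
        (ovlpm N ρ₁.1 ρ₁.2 ^ 2 * ovlpm N ρ₂.1 ρ₂.2 ^ 2)) ≤ 256 * b ^ 2 := by
  obtain ⟨m1, m2, m3, m4, m5, m6⟩ := EgibbsTS2_one_ovlpm_marginals hN ht hb0 hb
  have hm8 : EgibbsTS2 N β t 1 (fun _ ρ₂ => ovlp N ρ₂.1 ρ₂.2 ^ 8) ≤ b ^ 2 :=
    ((EgibbsTS2_one_cross hN fun σ τ => ovlp N σ τ ^ 8).1.trans_le
      (EgibbsTS2_one_ovlp_pow_le hN ht 8)).trans (Egibbs2_ovlp_le hN hb0 hb).2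
  refine ⟨?_, ?_, ?_, ?_⟩
  · have hp : ∀ r s : ℝ, (r ^ 2 * s ^ 2) ^ 2 ≤ 1 / 2 * r ^ 8 + 1 / 2 * s ^ 8 := fun r s => by
      nlinarith [sq_nonneg (r ^ 4 - s ^ 4)]
    have h := EgibbsTS2_one_mono (β := β) (t := t) hN
      fun ρ₁ ρ₂ => hp (ovlpm N ρ₁.1 ρ₁.2) (ovlp N ρ₂.1 ρ₂.2)
    rw [EgibbsTS2_one_add hN, EgibbsTS2_one_const_mul hN, EgibbsTS2_one_const_mul hN] at h
    nlinarith [sq_nonneg b]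
  · have h := EgibbsTS2_one_mono (β := β) (t := t) hN fun ρ₁ ρ₂ => Ufun_pow_eight_le hN hβ ht ρ₁ ρ₂
    rw [EgibbsTS2_one_const_mul hN, EgibbsTS2_one_add hN, EgibbsTS2_one_add hN,
      EgibbsTS2_one_add hN] at h
    linarith
  · exact (EgibbsTS2_one_mono hN fun ρ₁ _ => pairVar_pow_eight_le hN hβ ht ρ₁).trans m1
  · have hp : ∀ a r s : ℝ, a ^ 2 * (r ^ 2 * s ^ 2) ≤
        1 / 4 * r ^ 8 + (1 / 4 * s ^ 8 + 1 / 2 * a ^ 4) := fun a r s => by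
      nlinarith [sq_nonneg (r ^ 4 - s ^ 4), sq_nonneg (a ^ 2 - r ^ 2 * s ^ 2)]
    have h := EgibbsTS2_one_mono (β := β) (t := t) hN
      fun ρ₁ ρ₂ => hp (1 / (N : ℝ)) (ovlpm N ρ₁.1 ρ₁.2) (ovlpm N ρ₂.1 ρ₂.2)
    rw [EgibbsTS2_one_add hN, EgibbsTS2_one_add hN, EgibbsTS2_one_const_mul hN,
      EgibbsTS2_one_const_mul hN, EgibbsTS2_one_const_mul hN, EgibbsTS2_one_const hN] at h
    rw [EgibbsTS2_one_const_mul hN]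
    have h4 : (1 / (N : ℝ)) ^ 4 ≤ b ^ 2 := by
      have := pow_le_pow_left₀ (by positivity) (inv_sq_le_of_pow_eq hN ht hb0.le hb) 2
      rwa [← pow_mul] at this
    linarith [sq_nonneg b]

/-- The first-order term of the cavity expansion. -/
lemma replicaAvg_pairVar (hN : 0 < N) (hβ : β ∈ Set.Ioc (0 : ℝ) 1) (ht : t ∈ Set.Icc (0 : ℝ) 1) :
    replicaAvg (disM3 N) (cavProb N β t) (fun q =>
      ovlpm N q.1.1 q.1.2 ^ 2 * ovlp N q.2.1.1 q.2.1.2 ^ 2 * pairVar N β t q.2.1) =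
    2 * (1 / (N : ℝ)) * (β ^ 2 * t) * replicaAvg (disM3 N) (cavProb N β t) (fun q =>
      ovlpm N q.1.1 q.1.2 ^ 2 * ovlpm N q.2.1.1 q.2.1.2 ^ 2) := by
  have hS := cavitySystem (β := β) (t := t) hN hβ ht
  have hodd := replicaAvg_eq_zero_of_odd (μ := disM3 N) (p := cavProb N β t)
    ((Equiv.refl _).prodCongr ((flipLeft N).prodCongr (Equiv.refl _)))
    (fun q => by simp [replicaWeight, -flipLeft_apply, hS.p_θ])
    (fun q => ovlpm N q.1.1 q.1.2 ^ 2 * (ovlpm N q.2.1.1 q.2.1.2 ^ 2 + (1 / (N : ℝ)) ^ 2) *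
      pairVar N β t q.2.1)
    (fun q => by
      have := hS.v_θ q.2.1
      simp only [flipLeft_apply] at this
      simp [ovlpm_flipLast, this])
  rw [← replicaAvg_const_mul, eq_comm, ← zero_add (replicaAvg _ _ _), ← hodd, ← replicaAvg_add]
  congr 1
  funext q
  have e1 := spinLast_mul_self hN q.2.1.1
  have e2 := spinLast_mul_self hN q.2.1.2
  have hs : (spinLast q.2.1.1 * spinLast q.2.1.2) ^ 2 = 1 := by
    rw [mul_pow, sq, sq, e1, e2, one_mul]
  rw [ovlp_eq hN q.2.1.1, pairVar]
  generalize spinLast q.2.1.1 * spinLast q.2.1.2 = s at *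
  generalize ovlpm N q.1.1 q.1.2 = A
  generalize ovlpm N q.2.1.1 q.2.1.2 = B
  linear_combination -(A ^ 2 * B ^ 2 * (2 * (1 / (N : ℝ)) * (β ^ 2 * t)) +
    A ^ 2 * B * s * (1 / (N : ℝ)) ^ 2 * (β ^ 2 * t)) * hs

/-- A universal constant for the comparison of the cavity averages at `s = 0` and `s = 1`. -/
def decouplingConst : ℝ :=
  ((5 + 4 * (2 * exp 1 + exp 1 ^ 2)) * (10 * exp 28) * 10 + 1) * exp 12 * 2 ^ 25

lemma decouplingConst_pos : 0 < decouplingConst := by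
  unfold decouplingConst; positivity

/-- The comparison of the averages at `s = 0` and `s = 1`, before optimizing over `l`. -/
lemma abs_EgibbsTS2_zero_sub_one_le (hN : 0 < N) (hβ : β ∈ Set.Ioc (0 : ℝ) 1)
    (ht : t ∈ Set.Icc (0 : ℝ) 1) (hb0 : 0 < b)
    (hb : b ^ 3 = Egibbs2 N β (fun σ τ => ovlp N σ τ ^ 12)) {l : ℝ} (hl : 0 < l) :
    |EgibbsTS2 N β t 0 (fun ρ₁ ρ₂ => ovlpm N ρ₁.1 ρ₁.2 ^ 2 * ovlp N ρ₂.1 ρ₂.2 ^ 2) -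
        EgibbsTS2 N β t 1 (fun ρ₁ ρ₂ => ovlpm N ρ₁.1 ρ₁.2 ^ 2 * ovlp N ρ₂.1 ρ₂.2 ^ 2)| ≤
      decouplingConst * (l * EgibbsTS2 N β t 1
        (fun ρ₁ ρ₂ => ovlp N ρ₁.1 ρ₁.2 ^ 2 * ovlp N ρ₂.1 ρ₂.2 ^ 2) + l⁻¹ * b ^ 2) := by
  have hS := cavitySystem (β := β) (t := t) hN hβ ht
  obtain ⟨s1, s2⟩ := EgibbsTS2_one_second_order (β := β) (t := t) hN
  obtain ⟨f1, f2, f3, f4⟩ := EgibbsTS2_one_fourth_order hN hβ ht hb0 hb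
  have hX : 0 ≤ EgibbsTS2 N β t 1
      (fun ρ₁ ρ₂ => ovlp N ρ₁.1 ρ₁.2 ^ 2 * ovlp N ρ₂.1 ρ₂.2 ^ 2) :=
    (sq_nonneg _).trans (inv_sq_le_EgibbsTS2_one hN)
  have hfnn : ∀ ρ₁ ρ₂ : Config N × Config N,
      0 ≤ ovlpm N ρ₁.1 ρ₁.2 ^ 2 * ovlp N ρ₂.1 ρ₂.2 ^ 2 := fun _ _ => by positivity
  have hlin := replicaAvg_pairVar (β := β) (t := t) hN hβ ht
  have hexp := hS.abs_tiltedAvg_sub_le hfnn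
    (fun ρ₁ ρ₂ => by simp [ovlpm_flipLast, ovlpm_flipLast_right])
    (fun ρ₁ ρ₂ => by simp [ovlpm_flipLast])
  have hsq := hS.replicaAvg_exponentSq_le hfnn hl
  have r0 := hS.replicaAvg_le_tiltedAvg hfnn
  have r1 := hS.replicaAvg_le_tiltedAvg (f := fun ρ₁ ρ₂ =>
    (ovlpm N ρ₁.1 ρ₁.2 ^ 2 * ovlp N ρ₂.1 ρ₂.2 ^ 2) ^ 2) fun _ _ => by positivity
  have r2 := hS.replicaAvg_le_tiltedAvg (f := fun ρ₁ ρ₂ => (2 * Ufun N β t ρ₁ ρ₂) ^ 8)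
    fun _ _ => by positivity
  have r3 := hS.replicaAvg_le_tiltedAvg (f := fun ρ₁ _ => pairVar N β t ρ₁ ^ 8)
    fun _ _ => by positivity
  have r4 := hS.replicaAvg_le_tiltedAvg (f := fun ρ₁ ρ₂ => (1 / (N : ℝ)) ^ 2 *
    (ovlpm N ρ₁.1 ρ₁.2 ^ 2 * ovlpm N ρ₂.1 ρ₂.2 ^ 2)) fun _ _ => by positivity
  have r5 := hS.replicaAvg_le_tiltedAvg (f := fun ρ₁ ρ₂ =>
    ovlpm N ρ₁.1 ρ₁.2 ^ 2 * ovlpm N ρ₂.1 ρ₂.2 ^ 2) fun _ _ => by positivity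
  have hm0 : 0 ≤ replicaAvg (disM3 N) (cavProb N β t) (fun q =>
      ovlpm N q.1.1 q.1.2 ^ 2 * ovlpm N q.2.1.1 q.2.1.2 ^ 2) :=
    Finset.sum_nonneg fun q _ => mul_nonneg (replicaWeight_nonneg hS.nonneg q) (by positivity)
  rw [← EgibbsTS2_one] at hexp r0 r1 r2 r3 r4 r5
  rw [replicaAvg_const_mul] at r4
  rw [hlin] at hexp
  rw [EgibbsTS2_zero]
  have he := exp_pos 12
  replace r0 := r0.trans (mul_le_mul_of_nonneg_left s1 he.le)
  replace r1 := r1.trans (mul_le_mul_of_nonneg_left f1 he.le)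
  replace r2 := r2.trans (mul_le_mul_of_nonneg_left f2 he.le)
  replace r3 := r3.trans (mul_le_mul_of_nonneg_left f3 he.le)
  replace r4 := r4.trans (mul_le_mul_of_nonneg_left f4 he.le)
  replace r5 := r5.trans (mul_le_mul_of_nonneg_left s2 he.le)
  have hc0 : 0 ≤ β ^ 2 * t := mul_nonneg (sq_nonneg β) ht.1
  have hc1 : β ^ 2 * t ≤ 1 := mul_le_one₀ (pow_le_one₀ hβ.1.le hβ.2) ht.1 ht.2
  have ha0 : 0 ≤ 1 / (N : ℝ) := by positivity
  have hC : 0 < (5 + 4 * (2 * exp 1 + exp 1 ^ 2)) * (10 * exp 28) := by positivity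
  unfold decouplingConst
  clear f1 f2 f3 f4 s1 s2 hlin
  generalize EgibbsTS2 N β t 1
    (fun ρ₁ ρ₂ => ovlp N ρ₁.1 ρ₁.2 ^ 2 * ovlp N ρ₂.1 ρ₂.2 ^ 2) = X at *
  generalize EgibbsTS2 N β t 1
    (fun ρ₁ ρ₂ => ovlpm N ρ₁.1 ρ₁.2 ^ 2 * ovlp N ρ₂.1 ρ₂.2 ^ 2) = T at *
  generalize (5 + 4 * (2 * exp 1 + exp 1 ^ 2)) * (10 * exp 28) = C at *
  generalize exp 12 = e at *
  generalize replicaAvg (disM3 N) (cavProb N β t) (fun q =>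
    ovlpm N q.1.1 q.1.2 ^ 2 * ovlpm N q.2.1.1 q.2.1.2 ^ 2) = M at *
  generalize replicaAvg (disM3 N) (cavProb N β t) (fun q =>
    ovlpm N q.1.1 q.1.2 ^ 2 * ovlp N q.2.1.1 q.2.1.2 ^ 2) = F at *
  generalize β ^ 2 * t = c at *
  generalize 1 / (N : ℝ) = a at *
  have hli := inv_pos.mpr hl
  have hM1 : 2 * a * c * M ≤ 2 * a * M := by
    have := mul_le_mul_of_nonneg_left hc1 (mul_nonneg (mul_nonneg zero_le_two ha0) hm0)
    linarith
  have hM0 : 0 ≤ 2 * a * c * M := by positivity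
  have ha : 2 * a ≤ l + l⁻¹ * a ^ 2 := by
    have : l + l⁻¹ * a ^ 2 - 2 * a = l⁻¹ * (l - a) ^ 2 := by field_simp; ring
    have : 0 ≤ l⁻¹ * (l - a) ^ 2 := by positivity
    linarith
  have hM2 : 2 * a * M ≤ l * M + l⁻¹ * (a ^ 2 * M) := by
    have := mul_le_mul_of_nonneg_right ha hm0
    linarith
  have hM3 : 2 * a * c * M ≤ e * 2 ^ 25 * (l * X + l⁻¹ * b ^ 2) := by
    have k1 := mul_le_mul_of_nonneg_left r5 hl.le
    have k2 := mul_le_mul_of_nonneg_left r4 hli.le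
    have k3 : 0 ≤ e * (l * X) := by positivity
    have k4 : 0 ≤ e * (l⁻¹ * b ^ 2) := by positivity
    linarith
  have hq := add_le_add (mul_le_mul_of_nonneg_left r0 hl.le)
    (mul_le_mul_of_nonneg_left (add_le_add (add_le_add r1 r2) r3) hli.le)
  have hQ := hsq.trans (mul_le_mul_of_nonneg_left hq (by norm_num))
  have hE := hexp.trans (mul_le_mul_of_nonneg_left hQ hC.le)
  have hE' : C * (10 * (l * (e * (16 * X)) + l⁻¹ * (e * (256 * b ^ 2) + e * (2 ^ 24 * b ^ 2) +
      e * (256 * b ^ 2)))) ≤ C * 10 * e * 2 ^ 25 * (l * X + l⁻¹ * b ^ 2) := by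
    have k3 : 0 ≤ C * e * (l * X) := by positivity
    have k4 : 0 ≤ C * e * (l⁻¹ * b ^ 2) := by positivity
    linarith
  have hF := abs_le.1 (hE.trans hE')
  rw [abs_le]
  constructor <;> linarith [hF.1, hF.2]

end Decoupling

/-- comparison of `E⟨R⁻(σ¹,τ¹)²R(σ²,τ²)²⟩` at `s = 0` and `s = 1`
(= `⟨·⟩_t`), with the two stated upper bounds. -/
theorem sk_fourth_moment_decoupling :
    ∃ K : ℝ, 0 < K ∧ ∀ N : ℕ, 1 ≤ N → ∀ β ∈ Set.Ioc (0 : ℝ) 1, ∀ t ∈ Set.Icc (0 : ℝ) 1,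
      |EgibbsTS2 N β t 0 (fun ρ₁ ρ₂ => ovlpm N ρ₁.1 ρ₁.2 ^ 2 * ovlp N ρ₂.1 ρ₂.2 ^ 2) -
          EgibbsTS2 N β t 1 (fun ρ₁ ρ₂ => ovlpm N ρ₁.1 ρ₁.2 ^ 2 * ovlp N ρ₂.1 ρ₂.2 ^ 2)| ≤
        K * (EgibbsTS2 N β t 1
            (fun ρ₁ ρ₂ => ovlp N ρ₁.1 ρ₁.2 ^ 2 * ovlp N ρ₂.1 ρ₂.2 ^ 2)) ^ ((1 : ℝ) / 2) *
          (Egibbs2 N β (fun σ τ => ovlp N σ τ ^ 12)) ^ ((1 : ℝ) / 3) ∧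
      |EgibbsTS2 N β t 0 (fun ρ₁ ρ₂ => ovlpm N ρ₁.1 ρ₁.2 ^ 2 * ovlp N ρ₂.1 ρ₂.2 ^ 2) -
          EgibbsTS2 N β t 1 (fun ρ₁ ρ₂ => ovlpm N ρ₁.1 ρ₁.2 ^ 2 * ovlp N ρ₂.1 ρ₂.2 ^ 2)| ≤
        K * (Egibbs2 N β (fun σ τ => ovlp N σ τ ^ 12)) ^ ((1 : ℝ) / 2) := by
  refine ⟨2 * decouplingConst, mul_pos two_pos decouplingConst_pos, fun N hN β hβ t ht => ?_⟩
  have hN0 : (0 : ℝ) < N := by exact_mod_cast hN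
  have hm : 0 < Egibbs2 N β (fun σ τ => ovlp N σ τ ^ 12) :=
    lt_of_lt_of_le (by positivity) (inv_pow_six_le_Egibbs2 (β := β) hN ht)
  have hX : 0 < EgibbsTS2 N β t 1
      (fun ρ₁ ρ₂ => ovlp N ρ₁.1 ρ₁.2 ^ 2 * ovlp N ρ₂.1 ρ₂.2 ^ 2) :=
    lt_of_lt_of_le (by positivity) (inv_sq_le_EgibbsTS2_one hN)
  have hb0 := rpow_pos_of_pos hm ((1 : ℝ) / 3)
  have hb : (Egibbs2 N β (fun σ τ => ovlp N σ τ ^ 12) ^ ((1 : ℝ) / 3)) ^ 3 =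
      Egibbs2 N β (fun σ τ => ovlp N σ τ ^ 12) := by
    rw [← rpow_natCast, ← rpow_mul hm.le]; norm_num
  have hhalf : √(Egibbs2 N β (fun σ τ => ovlp N σ τ ^ 12) ^ ((1 : ℝ) / 3)) *
      Egibbs2 N β (fun σ τ => ovlp N σ τ ^ 12) ^ ((1 : ℝ) / 3) =
      Egibbs2 N β (fun σ τ => ovlp N σ τ ^ 12) ^ ((1 : ℝ) / 2) := by
    rw [sqrt_eq_rpow, ← rpow_mul hm.le, ← rpow_add hm]; norm_num
  have hXb := EgibbsTS2_one_sq_mul_sq_le hN ht hb0 hb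
  have hl := abs_EgibbsTS2_zero_sub_one_le hN hβ ht hb0 hb (div_pos hb0 (sqrt_pos.2 hX))
  rw [← sqrt_eq_rpow, ← hhalf]
  generalize Egibbs2 N β (fun σ τ => ovlp N σ τ ^ 12) ^ ((1 : ℝ) / 3) = b at *
  generalize EgibbsTS2 N β t 1
    (fun ρ₁ ρ₂ => ovlp N ρ₁.1 ρ₁.2 ^ 2 * ovlp N ρ₂.1 ρ₂.2 ^ 2) = X at *
  have hopt : b / √X * X + (b / √X)⁻¹ * b ^ 2 = 2 * (√X * b) := by
    have hs := sqrt_pos.2 hX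
    have hs2 : √X ^ 2 = X := sq_sqrt hX.le
    generalize √X = s at *
    subst hs2
    field_simp
    ring
  rw [hopt] at hl
  have hmono : √X * b ≤ √b * b := mul_le_mul_of_nonneg_right (sqrt_le_sqrt hXb) hb0.le
  have := mul_le_mul_of_nonneg_left hmono decouplingConst_pos.le
  constructor <;> linarith

end
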